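/- arXiv:1711.05804 — 3 statements merged into one kernel-verified Lean document; each statement's English description precedes it below -/
import Mathlib

section
/- Let X ⊆ ℝ^n and Y ⊆ ℝ^m be closed semialgebraic sets and let φ : X → Y be a continuous map. Then the following are equivalent: (a) for every relatively open semialgebraic subset U ⊆ Y and every QN function f : U → ℝ, the composition f ∘ φ is a QN function on φ^{-1}(U); (b) there exists a finite cover X = X_1 ∪ … ∪ X_N by relatively open semialgebraic subsets such that for each i the restriction φ|_{X_i} is an NQN map, i.e. there exist an open semialgebraic U_i ⊆ ℝ^n with X_i ⊆ U_i closed in U_i and a Nash map g_i : U_i → ℝ^m with g_i|_{X_i} = φ|_{X_i}. -/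
/-- A set `S ⊆ ℝⁿ` is semialgebraic if it is a finite union of sets of the form
`{x | p(x) = 0, q₁(x) > 0, …, q_r(x) > 0}` for real polynomials. -/
def IsSemialgebraic {n : ℕ} (S : Set (Fin n → ℝ)) : Prop :=
  ∃ (m : ℕ) (p : Fin m → MvPolynomial (Fin n) ℝ)
    (Q : Fin m → Finset (MvPolynomial (Fin n) ℝ)),
    S = ⋃ i, {x | MvPolynomial.eval x (p i) = 0 ∧ ∀ q ∈ Q i, 0 < MvPolynomial.eval x q}

/-- A Nash map on an open semialgebraic set `U ⊆ ℝⁿ` is a `C^∞` map `g : U → ℝ^m`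
whose graph is a semialgebraic subset of `ℝ^{n+m}`. -/
def IsNashMap {n m : ℕ} (U : Set (Fin n → ℝ)) (g : (Fin n → ℝ) → (Fin m → ℝ)) : Prop :=
  ContDiffOn ℝ (⊤ : ℕ∞) g U ∧
    IsSemialgebraic {p : Fin (n + m) → ℝ |
      (fun i => p (Fin.castAdd m i)) ∈ U ∧
      ∀ j, g (fun i => p (Fin.castAdd m i)) j = p (Fin.natAdd n j)}

/-- A Nash function on an open semialgebraic set `U ⊆ ℝⁿ` is a `C^∞` function
`g : U → ℝ` whose graph is a semialgebraic subset of `ℝ^{n+1}`. -/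
def IsNashFun {n : ℕ} (U : Set (Fin n → ℝ)) (g : (Fin n → ℝ) → ℝ) : Prop :=
  ContDiffOn ℝ (⊤ : ℕ∞) g U ∧
    IsSemialgebraic {p : Fin (n + 1) → ℝ |
      (fun i => p (Fin.castAdd 1 i)) ∈ U ∧
      g (fun i => p (Fin.castAdd 1 i)) = p (Fin.natAdd n 0)}

/-- An NQN map `h : X → ℝ^m` on a semialgebraic `X ⊆ ℝⁿ`: `h` (whose values matter
only on `X`) is the restriction to `X` of a Nash map on an open semialgebraic set
`U ⊇ X` in which `X` is closed. -/
def IsNQNMap {n m : ℕ} (X : Set (Fin n → ℝ)) (h : (Fin n → ℝ) → (Fin m → ℝ)) : Prop :=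
  ∃ U : Set (Fin n → ℝ), IsOpen U ∧ IsSemialgebraic U ∧ X ⊆ U ∧
    IsClosed ((Subtype.val ⁻¹' X : Set ↥U)) ∧
    ∃ g : (Fin n → ℝ) → (Fin m → ℝ), IsNashMap U g ∧ ∀ x ∈ X, g x = h x

/-- For a closed semialgebraic `X ⊆ ℝⁿ` and a relatively open semialgebraic `U ⊆ X`,
a function `f` (whose values matter only on `U`) is a QN function on `U` if there are
finitely many open semialgebraic sets `V j ⊆ ℝⁿ` and Nash functions `g j` on them,
such that the sets `V j ∩ X` cover `U` and `f` agrees with `g j` on `V j ∩ X`. -/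
def IsQNFunOn {n : ℕ} (X U : Set (Fin n → ℝ)) (f : (Fin n → ℝ) → ℝ) : Prop :=
  ∃ (M : ℕ) (V : Fin M → Set (Fin n → ℝ)) (g : Fin M → (Fin n → ℝ) → ℝ),
    (∀ j, IsOpen (V j)) ∧ (∀ j, IsSemialgebraic (V j)) ∧
    (∀ j, IsNashFun (V j) (g j)) ∧
    (⋃ j, V j ∩ X) = U ∧
    ∀ j, ∀ x ∈ V j ∩ X, f x = g j x

open Polynomial in
theorem TS_mono_left (P : ℝ[X]) {a b : ℝ} (hab : a < b)
    (h : ∀ t, a < t → t ≤ b → P.derivative.eval t ≠ 0) (hb : 0 < P.derivative.eval b) :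
    P.eval a < P.eval b := by
  obtain ⟨c, hc, hc'⟩ := exists_deriv_eq_slope (fun x => P.eval x) hab
    P.continuous.continuousOn P.differentiable.differentiableOn
  rw [Polynomial.deriv] at hc'
  have hpos : 0 < P.derivative.eval c := by
    by_contra hneg
    have hn : P.derivative.eval c ≤ 0 := not_lt.mp hneg
    obtain ⟨t, ht, ht'⟩ := intermediate_value_Icc hc.2.le
      (P.derivative.continuous.continuousOn) (show (0:ℝ) ∈ Set.Icc _ _ from ⟨hn, hb.le⟩)
    exact h t (lt_of_lt_of_le hc.1 ht.1) ht.2 ht'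
  rw [hc'] at hpos
  have := (div_pos_iff_of_pos_right (sub_pos.2 hab)).1 hpos
  linarith

open Polynomial in
theorem TS_mono_right (P : ℝ[X]) {a b : ℝ} (hab : a < b)
    (h : ∀ t, a ≤ t → t < b → P.derivative.eval t ≠ 0) (hb : 0 < P.derivative.eval a) :
    P.eval a < P.eval b := by
  obtain ⟨c, hc, hc'⟩ := exists_deriv_eq_slope (fun x => P.eval x) hab
    P.continuous.continuousOn P.differentiable.differentiableOn
  rw [Polynomial.deriv] at hc'
  have hpos : 0 < P.derivative.eval c := by
    by_contra hneg
    have hn : P.derivative.eval c ≤ 0 := not_lt.mp hneg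
    obtain ⟨t, ht, ht'⟩ := intermediate_value_Icc' hc.1.le
      (P.derivative.continuous.continuousOn) (show (0:ℝ) ∈ Set.Icc _ _ from ⟨hn, hb.le⟩)
    exact h t ht.1 (lt_of_le_of_lt ht.2 hc.2) ht'
  rw [hc'] at hpos
  have := (div_pos_iff_of_pos_right (sub_pos.2 hab)).1 hpos
  linarith

open Polynomial in
theorem TS_degree_pos (P : ℝ[X]) (h : P.derivative ≠ 0) : 0 < P.degree := by
  by_contra hn
  apply h
  rw [Polynomial.eq_C_of_degree_le_zero (not_lt.mp hn)]
  simp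

open Polynomial Filter in
theorem TS_neg_left (P : ℝ[X]) {b : ℝ}
    (h : ∀ t, t ≤ b → P.derivative.eval t ≠ 0) (hb : 0 < P.derivative.eval b) :
    ∃ w, w < b ∧ P.eval w < 0 := by
  have hd : 0 < (P.comp (-X)).degree := by
    have h0 : 0 < P.degree := TS_degree_pos P (by rintro h0; simp [h0] at hb)
    rw [← Polynomial.natDegree_pos_iff_degree_pos] at h0 ⊢
    rw [Polynomial.natDegree_comp]; simpa using h0
  have ht := Polynomial.abs_tendsto_atTop _ hd
  have := (ht.eventually (eventually_gt_atTop (|P.eval b|))).and (eventually_gt_atTop (-b))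
  obtain ⟨w, hw, hw'⟩ := this.exists
  simp at hw
  have hlt : -w < b := by linarith
  refine ⟨-w, hlt, ?_⟩
  have := TS_mono_left P hlt (fun t _ ht => h t ht) hb
  by_contra hn
  rw [abs_of_nonneg (not_lt.mp hn)] at hw
  linarith [le_abs_self (P.eval b)]

open Polynomial Filter in
theorem TS_pos_right (P : ℝ[X]) {b : ℝ}
    (h : ∀ t, b ≤ t → P.derivative.eval t ≠ 0) (hb : 0 < P.derivative.eval b) :
    ∃ w, b < w ∧ 0 < P.eval w := by
  have hd : 0 < P.degree := TS_degree_pos P (by rintro h0; simp [h0] at hb)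
  have ht := Polynomial.abs_tendsto_atTop _ hd
  have := (ht.eventually (eventually_gt_atTop (|P.eval b|))).and (eventually_gt_atTop (b))
  obtain ⟨w, hw, hlt⟩ := this.exists
  refine ⟨w, hlt, ?_⟩
  have := TS_mono_right P hlt (fun t ht _ => h t ht) hb
  by_contra hn
  rw [abs_of_nonpos (not_lt.mp hn)] at hw
  linarith [neg_abs_le (P.eval b)]

/-- `(x, y)` sits in the same position relative to every pair of `Z`. -/
def TSCompat (Z : Finset (ℝ × ℝ)) (x y : ℝ) : Prop :=
  ∀ z ∈ Z, (x < z.1 ↔ y < z.2) ∧ (z.1 < x ↔ z.2 < y)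

theorem TSCompat.eq {Z : Finset (ℝ × ℝ)} {x y : ℝ} (h : TSCompat Z x y) {z} (hz : z ∈ Z) :
    x = z.1 ↔ y = z.2 := by
  have := h z hz
  constructor
  · intro hh
    rcases lt_trichotomy y z.2 with h1 | h1 | h1
    · have := this.1.2 h1; linarith
    · exact h1
    · have := this.2.2 h1; linarith
  · intro hh
    rcases lt_trichotomy x z.1 with h1 | h1 | h1
    · have := this.1.1 h1; linarith
    · exact h1
    · have := this.2.1 h1; linarith

theorem TS_exists_compat {Z : Finset (ℝ × ℝ)} (hZ : ∀ z ∈ Z, TSCompat Z z.1 z.2) (x : ℝ) :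
    ∃ y, TSCompat Z x y := by
  classical
  by_cases hx : ∃ z ∈ Z, z.1 = x
  · obtain ⟨z, hz, rfl⟩ := hx
    exact ⟨z.2, hZ z hz⟩
  · push Not at hx
    obtain ⟨y, h1, h2⟩ := Order.exists_between_finsets
      (lo := (Z.filter (fun z => z.1 < x)).image Prod.snd)
      (hi := (Z.filter (fun z => x < z.1)).image Prod.snd) (by
        intro a ha b hb
        simp only [Finset.mem_image, Finset.mem_filter] at ha hb
        obtain ⟨z, ⟨hz, hzx⟩, rfl⟩ := ha
        obtain ⟨w, ⟨hw, hwx⟩, rfl⟩ := hb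
        exact ((hZ z hz) w hw).1.1 (hzx.trans hwx))
    refine ⟨y, fun z hz => ?_⟩
    simp only [Finset.mem_image, Finset.mem_filter] at h1 h2
    have hne := hx z hz
    rcases lt_or_gt_of_ne hne with h | h
    · have := h1 z.2 ⟨z, ⟨hz, h⟩, rfl⟩
      constructor <;> constructor <;> intro <;> linarith
    · have := h2 z.2 ⟨z, ⟨hz, h⟩, rfl⟩
      constructor <;> constructor <;> intro <;> linarith

open Polynomial in
theorem TS_ivt (P : ℝ[X]) {a b : ℝ} (hab : a ≤ b) (h : P.eval a * P.eval b ≤ 0) :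
    ∃ t, a ≤ t ∧ t ≤ b ∧ P.eval t = 0 := by
  rcases le_total (P.eval a) 0 with h0 | h0
  · by_cases hb : 0 ≤ P.eval b
    · obtain ⟨t, ht, ht'⟩ := intermediate_value_Icc hab (P.continuous.continuousOn)
        (show (0:ℝ) ∈ Set.Icc _ _ from ⟨h0, hb⟩)
      exact ⟨t, ht.1, ht.2, ht'⟩
    · have : P.eval a = 0 := by nlinarith
      exact ⟨a, le_rfl, hab, this⟩
  · by_cases hb : P.eval b ≤ 0
    · obtain ⟨t, ht, ht'⟩ := intermediate_value_Icc' hab (P.continuous.continuousOn)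
        (show (0:ℝ) ∈ Set.Icc _ _ from ⟨hb, h0⟩)
      exact ⟨t, ht.1, ht.2, ht'⟩
    · have : P.eval a = 0 := by nlinarith
      exact ⟨a, le_rfl, hab, this⟩

open Polynomial in
theorem TS_partner_pos {Z : Finset (ℝ × ℝ)} (hZ : ∀ z ∈ Z, TSCompat Z z.1 z.2) (P Q : ℝ[X])
    (hs : ∀ x y, TSCompat Z x y →
      SignType.sign (P.derivative.eval x) = SignType.sign (Q.derivative.eval y))
    (hP : ∀ x, P.derivative.eval x = 0 → ∃ y, (x, y) ∈ Z)
    (hQ : ∀ y, Q.derivative.eval y = 0 → ∃ x, (x, y) ∈ Z)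
    (hPQ : ∀ z ∈ Z, SignType.sign (P.eval z.1) = SignType.sign (Q.eval z.2))
    {x : ℝ} (hx : P.eval x = 0) (hxZ : ∀ z ∈ Z, z.1 ≠ x) (hpos : 0 < P.derivative.eval x) :
    ∃ y, Q.eval y = 0 ∧ TSCompat Z x y := by
  classical
  obtain ⟨y, hy⟩ := TS_exists_compat hZ x
  have hyZ : ∀ z ∈ Z, z.2 ≠ y := fun z hz h => hxZ z hz ((hy.eq hz).2 h.symm).symm
  have hQpos : 0 < Q.derivative.eval y := by
    have := hs x y hy
    rw [sign_pos hpos] at this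
    exact sign_eq_one_iff.1 this.symm
  rcases lt_trichotomy (Q.eval y) 0 with h | h | h
  · -- root to the right
    have key : ∃ w, y < w ∧ 0 < Q.eval w ∧ ∀ z ∈ Z, y < z.2 → w ≤ z.2 := by
      by_cases hne : (Z.filter (fun z => y < z.2)).Nonempty
      · obtain ⟨u, hu, humax⟩ := Finset.exists_min_image _ Prod.snd hne
        simp only [Finset.mem_filter] at hu humax
        refine ⟨u.2, hu.2, ?_, fun z hz hzy => humax z ⟨hz, hzy⟩⟩
        have hux : x < u.1 := (hy u hu.1).1.2 hu.2
        have : P.eval x < P.eval u.1 := by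
          refine TS_mono_right P hux (fun t ht1 ht2 ht0 => ?_) hpos
          obtain ⟨s, hs'⟩ := hP t ht0
          have hne := hxZ _ hs'
          have hxt : x < t := lt_of_le_of_ne ht1 (Ne.symm hne)
          have h1 : y < s := ((hy _ hs').1).1 hxt
          have h2 := humax _ ⟨hs', h1⟩
          have h3 := ((hZ u hu.1) _ hs').2.1 ht2
          simp only at h2 h3
          linarith
        rw [hx] at this
        have h1 := hPQ u hu.1
        rw [sign_pos this] at h1
        exact sign_eq_one_iff.1 h1.symm
      · rw [Finset.not_nonempty_iff_eq_empty, Finset.filter_eq_empty_iff] at hne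
        obtain ⟨w, hw, hw'⟩ := TS_pos_right Q (b := y) (fun t ht ht0 => by
          obtain ⟨s, hs'⟩ := hQ t ht0
          have h1 := hne hs'
          have h2 := hyZ _ hs'
          simp only at h1 h2
          exact h1 (lt_of_le_of_ne ht (Ne.symm h2))) hQpos
        exact ⟨w, hw, hw', fun z hz h => absurd h (hne hz)⟩
    obtain ⟨w, hw, hw', hwZ⟩ := key
    obtain ⟨t, ht1, ht2, ht0⟩ := TS_ivt Q hw.le (by nlinarith)
    have htw : t < w := lt_of_le_of_ne ht2 (by rintro rfl; linarith)
    refine ⟨t, ht0, fun z hz => ?_⟩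
    rw [(hy z hz).1, (hy z hz).2]
    rcases lt_or_gt_of_ne (hyZ z hz) with h3 | h3
    · constructor <;> constructor <;> intro <;> linarith
    · have := hwZ z hz h3
      constructor <;> constructor <;> intro <;> linarith
  · exact ⟨y, h, hy⟩
  · have key : ∃ w, w < y ∧ Q.eval w < 0 ∧ ∀ z ∈ Z, z.2 < y → z.2 ≤ w := by
      by_cases hne : (Z.filter (fun z => z.2 < y)).Nonempty
      · obtain ⟨u, hu, humax⟩ := Finset.exists_max_image _ Prod.snd hne
        simp only [Finset.mem_filter] at hu humax
        refine ⟨u.2, hu.2, ?_, fun z hz hzy => humax z ⟨hz, hzy⟩⟩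
        have hux : u.1 < x := (hy u hu.1).2.2 hu.2
        have : P.eval u.1 < P.eval x := by
          refine TS_mono_left P hux (fun t ht1 ht2 ht0 => ?_) hpos
          obtain ⟨s, hs'⟩ := hP t ht0
          have hne := hxZ _ hs'
          have hxt : t < x := lt_of_le_of_ne ht2 hne
          have h1 : s < y := ((hy _ hs').2).1 hxt
          have h2 := humax _ ⟨hs', h1⟩
          have h3 := ((hZ u hu.1) _ hs').1.1 ht1
          simp only at h2 h3
          linarith
        rw [hx] at this
        have h1 := hPQ u hu.1
        rw [sign_neg this] at h1
        exact sign_eq_neg_one_iff.1 h1.symm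
      · rw [Finset.not_nonempty_iff_eq_empty, Finset.filter_eq_empty_iff] at hne
        obtain ⟨w, hw, hw'⟩ := TS_neg_left Q (b := y) (fun t ht ht0 => by
          obtain ⟨s, hs'⟩ := hQ t ht0
          have h1 := hne hs'
          have h2 := hyZ _ hs'
          simp only at h1 h2
          exact h1 (lt_of_le_of_ne ht h2)) hQpos
        exact ⟨w, hw, hw', fun z hz h => absurd h (hne hz)⟩
    obtain ⟨w, hw, hw', hwZ⟩ := key
    obtain ⟨t, ht1, ht2, ht0⟩ := TS_ivt Q hw.le (by nlinarith)
    have htw : w < t := lt_of_le_of_ne ht1 (by rintro rfl; linarith)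
    refine ⟨t, ht0, fun z hz => ?_⟩
    rw [(hy z hz).1, (hy z hz).2]
    rcases lt_or_gt_of_ne (hyZ z hz) with h3 | h3
    · have := hwZ z hz h3
      constructor <;> constructor <;> intro <;> linarith
    · constructor <;> constructor <;> intro <;> linarith

theorem TS_sign_neg (a : ℝ) : SignType.sign (-a) = - SignType.sign a := Left.sign_neg a

open Polynomial in
theorem TS_partner {Z : Finset (ℝ × ℝ)} (hZ : ∀ z ∈ Z, TSCompat Z z.1 z.2) (P Q : ℝ[X])
    (hs : ∀ x y, TSCompat Z x y →
      SignType.sign (P.derivative.eval x) = SignType.sign (Q.derivative.eval y))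
    (hP : ∀ x, P.derivative.eval x = 0 → ∃ y, (x, y) ∈ Z)
    (hQ : ∀ y, Q.derivative.eval y = 0 → ∃ x, (x, y) ∈ Z)
    (hPQ : ∀ z ∈ Z, SignType.sign (P.eval z.1) = SignType.sign (Q.eval z.2))
    {x : ℝ} (hx : P.eval x = 0) :
    ∃ y, Q.eval y = 0 ∧ TSCompat Z x y := by
  by_cases hxZ : ∃ z ∈ Z, z.1 = x
  · obtain ⟨z, hz, rfl⟩ := hxZ
    refine ⟨z.2, ?_, hZ z hz⟩
    have := hPQ z hz
    rw [hx, sign_zero] at this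
    exact sign_eq_zero_iff.1 this.symm
  push Not at hxZ
  rcases lt_trichotomy (P.derivative.eval x) 0 with h | h | h
  · obtain ⟨y, hy, hy'⟩ := TS_partner_pos hZ (-P) (-Q) (by simpa [TS_sign_neg] using hs)
      (by simpa using hP) (by simpa using hQ) (by simpa [TS_sign_neg] using hPQ) (x := x)
      (by simpa using hx) hxZ (by simpa using h)
    exact ⟨y, by simpa using hy, hy'⟩
  · obtain ⟨y, hy⟩ := hP x h
    exact absurd rfl (hxZ _ hy)
  · exact TS_partner_pos hZ P Q hs hP hQ hPQ hx hxZ h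

open Polynomial in
theorem TS_sign_aux {Z : Finset (ℝ × ℝ)} (hZ : ∀ z ∈ Z, TSCompat Z z.1 z.2) (P Q : ℝ[X])
    (hs : ∀ x y, TSCompat Z x y →
      SignType.sign (P.derivative.eval x) = SignType.sign (Q.derivative.eval y))
    (hP : ∀ x, P.derivative.eval x = 0 → ∃ y, (x, y) ∈ Z)
    (hQ : ∀ y, Q.derivative.eval y = 0 → ∃ x, (x, y) ∈ Z)
    (hP0 : ∀ x, P.eval x = 0 → ∃ y, (x, y) ∈ Z)
    (hQ0 : ∀ y, Q.eval y = 0 → ∃ x, (x, y) ∈ Z)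
    (hPQ : ∀ z ∈ Z, SignType.sign (P.eval z.1) = SignType.sign (Q.eval z.2))
    {x y : ℝ} (hxZ : ∀ z ∈ Z, z.1 ≠ x) (hxy : TSCompat Z x y) (hx : 0 < P.eval x) :
    0 < Q.eval y := by
  classical
  have hyZ : ∀ z ∈ Z, z.2 ≠ y := fun z hz h => hxZ z hz ((hxy.eq hz).2 h.symm).symm
  by_contra hQy
  have hQy0 : Q.eval y ≠ 0 := fun h => by
    obtain ⟨s, hs⟩ := hQ0 y h
    exact hyZ _ hs rfl
  have hQy' : Q.eval y < 0 := lt_of_le_of_ne (not_lt.1 hQy) hQy0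
  by_cases hne : (Z.filter (fun z => z.2 < y)).Nonempty
  · obtain ⟨u, hu, humax⟩ := Finset.exists_max_image _ Prod.snd hne
    simp only [Finset.mem_filter] at hu humax
    have hux : u.1 < x := (hxy u hu.1).2.2 hu.2
    have hno : ∀ t s, (t, s) ∈ Z → u.1 < t → t ≤ x → False := by
      intro t s hts h1 h2
      have h3 := hxZ _ hts
      have h4 : t < x := lt_of_le_of_ne h2 h3
      have h5 := ((hxy _ hts).2).1 h4
      have h6 := humax _ ⟨hts, h5⟩
      have h7 := ((hZ u hu.1) _ hts).1.1 h1
      simp only at h6 h7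
      linarith
    have hno2 : ∀ t s, (t, s) ∈ Z → u.2 < s → s ≤ y → False := by
      intro t s hts h1 h2
      have h4 : s < y := lt_of_le_of_ne h2 (hyZ _ hts)
      have h6 := humax _ ⟨hts, h4⟩
      simp only at h6
      linarith
    have hsu := hPQ u hu.1
    rcases lt_trichotomy (P.eval u.1) 0 with h | h | h
    · obtain ⟨t, h1, h2, h3⟩ := TS_ivt P hux.le (by nlinarith)
      obtain ⟨s, hs'⟩ := hP0 t h3
      exact hno t s hs' (lt_of_le_of_ne h1 (by rintro rfl; linarith)) h2
    · rw [h, sign_zero] at hsu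
      have hQu : Q.eval u.2 = 0 := sign_eq_zero_iff.1 hsu.symm
      have hd := hs x y hxy
      rcases lt_trichotomy (P.derivative.eval x) 0 with h' | h' | h'
      · have := TS_mono_left (-P) hux (fun t h1 h2 h3 => by
          obtain ⟨s, hs'⟩ := hP t (by simpa using h3)
          exact hno t s hs' h1 h2) (by simpa using h')
        simp [h] at this
        linarith
      · obtain ⟨s, hs'⟩ := hP x h'
        exact hxZ _ hs' rfl
      · rw [sign_pos h'] at hd
        have := TS_mono_left Q hu.2 (fun t h1 h2 h3 => by
          obtain ⟨s, hs'⟩ := hQ t h3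
          exact hno2 s t hs' h1 h2) (sign_eq_one_iff.1 hd.symm)
        linarith
    · rw [sign_pos h] at hsu
      have hQu := sign_eq_one_iff.1 hsu.symm
      obtain ⟨t, h1, h2, h3⟩ := TS_ivt Q hu.2.le (by nlinarith)
      obtain ⟨s, hs'⟩ := hQ0 t h3
      exact hno2 s t hs' (lt_of_le_of_ne h1 (by rintro rfl; linarith)) h2
  · rw [Finset.not_nonempty_iff_eq_empty, Finset.filter_eq_empty_iff] at hne
    have hno2 : ∀ t s, (t, s) ∈ Z → s ≤ y → False := by
      intro t s hts h2
      exact hne hts (lt_of_le_of_ne h2 (hyZ _ hts))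
    have hno : ∀ t s, (t, s) ∈ Z → t ≤ x → False := by
      intro t s hts h2
      exact hne hts (((hxy _ hts).2).1 (lt_of_le_of_ne h2 (hxZ _ hts)))
    have hd := hs x y hxy
    rcases lt_trichotomy (P.derivative.eval x) 0 with h' | h' | h'
    · rw [sign_neg h'] at hd
      have hd' := sign_eq_neg_one_iff.1 hd.symm
      obtain ⟨w, hw, hw'⟩ := TS_neg_left (-Q) (b := y) (fun t h2 h3 => by
          obtain ⟨s, hs'⟩ := hQ t (by simpa using h3)
          exact hno2 s t hs' h2) (by simpa using hd')
      simp at hw'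
      obtain ⟨t, h1, h2, h3⟩ := TS_ivt Q hw.le (by nlinarith)
      obtain ⟨s, hs'⟩ := hQ0 t h3
      exact hno2 s t hs' h2
    · obtain ⟨s, hs'⟩ := hP x h'
      exact hxZ _ hs' rfl
    · obtain ⟨w, hw, hw'⟩ := TS_neg_left P (b := x) (fun t h2 h3 => by
          obtain ⟨s, hs'⟩ := hP t (by simpa using h3)
          exact hno t s hs' h2) h'
      obtain ⟨t, h1, h2, h3⟩ := TS_ivt P hw.le (by nlinarith)
      obtain ⟨s, hs'⟩ := hP0 t h3
      exact hno t s hs' h2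

open Polynomial in
theorem TS_sign {Z : Finset (ℝ × ℝ)} (hZ : ∀ z ∈ Z, TSCompat Z z.1 z.2) (P Q : ℝ[X])
    (hs : ∀ x y, TSCompat Z x y →
      SignType.sign (P.derivative.eval x) = SignType.sign (Q.derivative.eval y))
    (hP : ∀ x, P.derivative.eval x = 0 → ∃ y, (x, y) ∈ Z)
    (hQ : ∀ y, Q.derivative.eval y = 0 → ∃ x, (x, y) ∈ Z)
    (hP0 : ∀ x, P.eval x = 0 → ∃ y, (x, y) ∈ Z)
    (hQ0 : ∀ y, Q.eval y = 0 → ∃ x, (x, y) ∈ Z)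
    (hPQ : ∀ z ∈ Z, SignType.sign (P.eval z.1) = SignType.sign (Q.eval z.2))
    {x y : ℝ} (hxy : TSCompat Z x y) :
    SignType.sign (P.eval x) = SignType.sign (Q.eval y) := by
  by_cases hxZ : ∃ z ∈ Z, z.1 = x
  · obtain ⟨z, hz, rfl⟩ := hxZ
    rw [(hxy.eq hz).1 rfl]
    exact hPQ z hz
  push Not at hxZ
  rcases lt_trichotomy (P.eval x) 0 with h | h | h
  · have := TS_sign_aux hZ (-P) (-Q) (by simpa [TS_sign_neg] using hs)
      (by simpa using hP) (by simpa using hQ) (by simpa using hP0) (by simpa using hQ0)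
      (by simpa [TS_sign_neg] using hPQ) hxZ hxy (by simpa using h)
    rw [sign_neg h, sign_neg (by simpa using this)]
  · obtain ⟨y, hy⟩ := hP0 x h
    exact absurd rfl (hxZ _ hy)
  · have := TS_sign_aux hZ P Q hs hP hQ hP0 hQ0 hPQ hxZ hxy h
    rw [sign_pos h, sign_pos this]

open Polynomial in
/-- `Z` witnesses that the pairs of polynomials of `G` have the same sign diagram. -/
def TSInvZ (G : Set (ℝ[X] × ℝ[X])) (Z : Finset (ℝ × ℝ)) : Prop :=
  (∀ z ∈ Z, TSCompat Z z.1 z.2) ∧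
  (∀ z ∈ Z, ∃ f ∈ G, f.1 ≠ 0 ∧ f.1.eval z.1 = 0) ∧
  ∀ f ∈ G, (f.1 = 0 ↔ f.2 = 0) ∧
    (∀ x y, TSCompat Z x y → SignType.sign (f.1.eval x) = SignType.sign (f.2.eval y)) ∧
    (f.1 ≠ 0 → ∀ x, f.1.eval x = 0 → ∃ y, (x, y) ∈ Z) ∧
    (f.2 ≠ 0 → ∀ y, f.2.eval y = 0 → ∃ x, (x, y) ∈ Z)

open Polynomial in
theorem TS_restrict {G G' : Set (ℝ[X] × ℝ[X])} (hG : G ⊆ G') {Z : Finset (ℝ × ℝ)}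
    (h : TSInvZ G' Z) : ∃ Z', Z' ⊆ Z ∧ TSInvZ G Z' := by
  classical
  obtain ⟨h1, h2, h3⟩ := h
  refine ⟨Z.filter (fun z => ∃ f ∈ G, f.1 ≠ 0 ∧ f.1.eval z.1 = 0), Finset.filter_subset _ _, ?_, ?_, ?_⟩
  · intro z hz w hw
    exact h1 z (Finset.mem_filter.1 hz).1 w (Finset.mem_filter.1 hw).1
  · intro z hz
    exact (Finset.mem_filter.1 hz).2
  · intro f hf
    obtain ⟨h4, h5, h6, h7⟩ := h3 f (hG hf)
    have h6' : f.1 ≠ 0 → ∀ x, f.1.eval x = 0 → ∃ y,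
        (x, y) ∈ Z.filter (fun z => ∃ f ∈ G, f.1 ≠ 0 ∧ f.1.eval z.1 = 0) := by
      intro hf0 x hx
      obtain ⟨y, hy⟩ := h6 hf0 x hx
      exact ⟨y, Finset.mem_filter.2 ⟨hy, f, hf, hf0, hx⟩⟩
    have h7' : f.2 ≠ 0 → ∀ y, f.2.eval y = 0 → ∃ x,
        (x, y) ∈ Z.filter (fun z => ∃ f ∈ G, f.1 ≠ 0 ∧ f.1.eval z.1 = 0) := by
      intro hf0 y hy
      obtain ⟨x, hx⟩ := h7 hf0 y hy
      refine ⟨x, Finset.mem_filter.2 ⟨hx, f, hf, fun h => hf0 (h4.1 h), ?_⟩⟩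
      have := h5 _ _ (h1 _ hx)
      simp only at this
      rw [hy, sign_zero] at this
      exact sign_eq_zero_iff.1 this
    refine ⟨h4, ?_, h6', h7'⟩
    intro x y hxy
    obtain ⟨y', hy'⟩ := TS_exists_compat h1 x
    rw [h5 x y' hy']
    by_cases hf0 : f.2 = 0
    · simp [hf0]
    by_contra hsne
    have key : ∀ a b, a ≤ b → (∀ t, a ≤ t → t ≤ b → f.2.eval t ≠ 0) →
        SignType.sign (f.2.eval a) = SignType.sign (f.2.eval b) := by
      intro a b hab hno
      by_contra hne
      have : f.2.eval a * f.2.eval b ≤ 0 := by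
        by_contra hpos
        rcases pos_and_pos_or_neg_and_neg_of_mul_pos (not_le.1 hpos) with h | h
        · exact hne (by rw [sign_pos h.1, sign_pos h.2])
        · exact hne (by rw [sign_neg h.1, sign_neg h.2])
      obtain ⟨t, ha, hb, ht⟩ := TS_ivt f.2 hab this
      exact hno t ha hb ht
    have hyne : y ≠ y' := by rintro rfl; exact hsne rfl
    rcases lt_or_gt_of_ne hyne with hlt | hlt
    · apply hsne
      refine (key y y' hlt.le fun t ha hb ht => ?_).symm
      obtain ⟨s, hs⟩ := h7' hf0 t ht
      have e1 := hxy _ hs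
      have e2 := hy' _ (Finset.mem_filter.1 hs).1
      have e3 := e1.1.symm.trans e2.1
      have e4 := e1.2.symm.trans e2.2
      simp only at e3 e4
      rcases lt_or_eq_of_le ha with h | h
      · have := e3.1 h; linarith
      · have := e4.2 (by linarith); linarith
    · apply hsne
      refine key y' y hlt.le fun t ha hb ht => ?_
      obtain ⟨s, hs⟩ := h7' hf0 t ht
      have e1 := hxy _ hs
      have e2 := hy' _ (Finset.mem_filter.1 hs).1
      have e3 := e1.1.symm.trans e2.1
      have e4 := e1.2.symm.trans e2.2
      simp only at e3 e4
      rcases lt_or_eq_of_le ha with h | h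
      · have := e3.2 h; linarith
      · have := e4.1 (by linarith); linarith

open Polynomial in
theorem TS_step {G : Set (ℝ[X] × ℝ[X])} {Z : Finset (ℝ × ℝ)} (h : TSInvZ G Z) (P Q : ℝ[X])
    (hG : (P.derivative, Q.derivative) ∈ G) (hP' : P.derivative ≠ 0) (hQ' : Q.derivative ≠ 0)
    (hPQ : ∀ z ∈ Z, SignType.sign (P.eval z.1) = SignType.sign (Q.eval z.2)) :
    ∃ Z', TSInvZ (insert (P, Q) G) Z' := by
  classical
  obtain ⟨h1, h2, h3⟩ := h
  obtain ⟨-, hs, hPr, hQr⟩ := h3 _ hG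
  simp only at hs hPr hQr
  have hPr := hPr hP'
  have hQr := hQr hQ'
  have hP0 : P ≠ 0 := by rintro rfl; simp at hP'
  have hQ0 : Q ≠ 0 := by rintro rfl; simp at hQ'
  set N := (P.roots.toFinset ×ˢ Q.roots.toFinset).filter (fun z => TSCompat Z z.1 z.2) with hN
  have hmemN : ∀ z, z ∈ N ↔ P.eval z.1 = 0 ∧ Q.eval z.2 = 0 ∧ TSCompat Z z.1 z.2 := by
    intro z
    simp [hN, hP0, hQ0, and_assoc]
  have hcompat : ∀ z ∈ Z ∪ N, TSCompat Z z.1 z.2 := by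
    intro z hz
    rcases Finset.mem_union.1 hz with hz | hz
    · exact h1 z hz
    · exact ((hmemN z).1 hz).2.2
  have hNN : ∀ z ∈ N, ∀ w ∈ N, z.1 < w.1 ↔ z.2 < w.2 := by
    intro z hz w hw
    obtain ⟨z1, z2, z3⟩ := (hmemN z).1 hz
    obtain ⟨w1, w2, w3⟩ := (hmemN w).1 hw
    constructor
    · intro hlt
      obtain ⟨c, hc, hc'⟩ := exists_deriv_eq_zero (f := fun x => P.eval x) hlt
        P.continuous.continuousOn (by simp [z1, w1])
      rw [Polynomial.deriv] at hc'
      obtain ⟨s, hs'⟩ := hPr c hc'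
      exact ((z3 _ hs').1.1 hc.1).trans ((w3 _ hs').2.1 hc.2)
    · intro hlt
      obtain ⟨c, hc, hc'⟩ := exists_deriv_eq_zero (f := fun x => Q.eval x) hlt
        Q.continuous.continuousOn (by simp [z2, w2])
      rw [Polynomial.deriv] at hc'
      obtain ⟨s, hs'⟩ := hQr c hc'
      exact ((z3 _ hs').1.2 hc.1).trans ((w3 _ hs').2.2 hc.2)
  have hU : ∀ z ∈ Z ∪ N, TSCompat (Z ∪ N) z.1 z.2 := by
    intro z hz w hw
    rcases Finset.mem_union.1 hw with hw' | hw'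
    · exact hcompat z hz w hw'
    · rcases Finset.mem_union.1 hz with hz' | hz'
      · exact ⟨(hcompat w hw z hz').2, (hcompat w hw z hz').1⟩
      · exact ⟨hNN z hz' w hw', hNN w hw' z hz'⟩
  have hmono : ∀ x y, TSCompat (Z ∪ N) x y → TSCompat Z x y :=
    fun x y h z hz => h z (Finset.mem_union_left _ hz)
  have hProot : ∀ x, P.eval x = 0 → ∃ y, (x, y) ∈ Z ∪ N := by
    intro x hx
    obtain ⟨y, hy, hy'⟩ := TS_partner h1 P Q hs hPr hQr hPQ hx
    exact ⟨y, Finset.mem_union_right _ ((hmemN _).2 ⟨hx, hy, hy'⟩)⟩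
  have hswap : ∀ x y, TSCompat (Z.image Prod.swap) y x ↔ TSCompat Z x y := by
    intro x y
    unfold TSCompat
    constructor
    · intro h z hz
      have := h z.swap (Finset.mem_image_of_mem _ hz)
      exact ⟨this.1.symm, this.2.symm⟩
    · intro h z hz
      obtain ⟨w, hw, rfl⟩ := Finset.mem_image.1 hz
      have := h w hw
      exact ⟨this.1.symm, this.2.symm⟩
  have hmemswap : ∀ x y, (y, x) ∈ Z.image Prod.swap ↔ (x, y) ∈ Z := by
    intro x y
    simp
  have hQroot : ∀ y, Q.eval y = 0 → ∃ x, (x, y) ∈ Z ∪ N := by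
    intro y hy
    obtain ⟨x, hx, hx'⟩ := TS_partner (Z := Z.image Prod.swap) (by
        intro z hz
        obtain ⟨w, hw, rfl⟩ := Finset.mem_image.1 hz
        exact (hswap _ _).2 (h1 w hw)) Q P (fun y x h => (hs x y ((hswap _ _).1 h)).symm)
      (by simpa only [hmemswap] using hQr) (by simpa only [hmemswap] using hPr)
      (by
        intro z hz
        obtain ⟨w, hw, rfl⟩ := Finset.mem_image.1 hz
        exact (hPQ w hw).symm) hy
    exact ⟨x, Finset.mem_union_right _ ((hmemN _).2 ⟨hx, hy, (hswap _ _).1 hx'⟩)⟩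
  have hZU : ∀ z, z ∈ Z → z ∈ Z ∪ N := fun z hz => Finset.mem_union_left _ hz
  refine ⟨Z ∪ N, hU, ?_, ?_⟩
  · intro z hz
    rcases Finset.mem_union.1 hz with hz | hz
    · obtain ⟨f, hf, hf'⟩ := h2 z hz
      exact ⟨f, Set.mem_insert_of_mem _ hf, hf'⟩
    · exact ⟨(P, Q), Set.mem_insert _ _, hP0, ((hmemN z).1 hz).1⟩
  · intro f hf
    rcases hf with rfl | hf
    · refine ⟨by simp [hP0, hQ0], ?_, fun _ => hProot, fun _ => hQroot⟩
      intro x y hxy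
      refine TS_sign hU P Q (fun x y h => hs x y (hmono x y h))
        (fun x hx => (hPr x hx).imp fun _ => hZU _)
        (fun x hx => (hQr x hx).imp fun _ => hZU _) hProot hQroot ?_ hxy
      intro z hz
      rcases Finset.mem_union.1 hz with hz | hz
      · exact hPQ z hz
      · rw [((hmemN z).1 hz).1, ((hmemN z).1 hz).2.1]
    · obtain ⟨h4, h5, h6, h7⟩ := h3 f hf
      exact ⟨h4, fun x y h => h5 x y (hmono x y h),
        fun h x hx => (h6 h x hx).imp fun _ => hZU _,
        fun h x hx => (h7 h x hx).imp fun _ => hZU _⟩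

open Polynomial in
theorem TS_rem_eval {R : Type*} [CommRing R] (γ : R →+* ℝ) (p q : R[X]) (D j : ℕ)
    (hp : p.natDegree = D) (hj : j ≤ D) (hq : ∀ i, j < i → γ (q.coeff i) = 0) (z : ℝ)
    (hz : (q.map γ).eval z = 0) :
    ((C (q.coeff j) * p.eraseLead - C p.leadingCoeff *
      ∑ i ∈ Finset.range j, C (q.coeff i) * X ^ (i + (D - j))).map γ).eval z
      = γ (q.coeff j) * (p.map γ).eval z := by
  have hsum : (q.map γ).eval z
      = ∑ i ∈ Finset.range j, γ (q.coeff i) * z ^ i + γ (q.coeff j) * z ^ j := by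
    rw [Polynomial.eval_eq_sum_range' (n := max (q.natDegree + 1) (j + 1))
      (lt_of_lt_of_le (Nat.lt_succ_of_le Polynomial.natDegree_map_le) (le_max_left _ _)),
      ← Finset.sum_range_succ (fun i => γ (q.coeff i) * z ^ i)]
    simp only [Polynomial.coeff_map]
    symm
    apply Finset.sum_subset
    · intro i hi
      simp only [Finset.mem_range] at *
      exact lt_of_lt_of_le hi (le_max_right _ _)
    · intro i _ hi
      simp only [Finset.mem_range] at hi
      rw [hq i (by omega), zero_mul]
  have hpe : (p.map γ).eval z = (p.eraseLead.map γ).eval z + γ p.leadingCoeff * z ^ D := by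
    conv_lhs => rw [← Polynomial.eraseLead_add_C_mul_X_pow p]
    simp [hp]
  have hpow : z ^ D = z ^ j * z ^ (D - j) := by rw [← pow_add]; congr 1; omega
  rw [hpe, hpow]
  simp only [Polynomial.map_sub, Polynomial.map_mul, Polynomial.map_C, Polynomial.eval_sub,
    Polynomial.eval_mul, Polynomial.eval_C, Polynomial.map_sum, Polynomial.eval_finsetSum,
    Polynomial.map_pow, Polynomial.map_X, Polynomial.eval_pow, Polynomial.eval_X, pow_add]
  simp only [← mul_assoc]
  rw [← Finset.sum_mul]
  rw [hz] at hsum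
  have : ∑ i ∈ Finset.range j, γ (q.coeff i) * z ^ i = - (γ (q.coeff j) * z ^ j) := by linarith
  rw [this]
  ring

theorem TS_sign_zero {a b : ℝ} (h : SignType.sign a = SignType.sign b) : a = 0 ↔ b = 0 := by
  rw [← sign_eq_zero_iff, h, sign_eq_zero_iff]

open Polynomial in
/-- pairs of specialisations of a finite family of polynomials -/
def TSPairs {R : Type*} [CommRing R] (F : Finset R[X]) (α β : R →+* ℝ) : Set (ℝ[X] × ℝ[X]) :=
  {f | ∃ p ∈ F, f = (p.map α, p.map β)}

open Polynomial in
theorem TS_main {R : Type*} [CommRing R] (D : ℕ) : ∀ (k : ℕ) (F : Finset R[X]),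
    (∀ p ∈ F, p.natDegree ≤ D) → ({p ∈ F | p.natDegree = D}).card ≤ k →
    ∃ C : Finset R, ∀ α β : R →+* ℝ,
      (∀ c ∈ C, SignType.sign (α c) = SignType.sign (β c)) →
      ∃ Z, TSInvZ (TSPairs F α β) Z := by
  classical
  induction D with
  | zero =>
    intro k F hF _
    refine ⟨F.image (fun p => p.coeff 0), fun α β hC => ⟨∅, by simp, by simp, ?_⟩⟩
    rintro f ⟨p, hp, rfl⟩
    have hpc := Polynomial.eq_C_of_natDegree_le_zero (hF p hp)
    have hs := hC (p.coeff 0) (Finset.mem_image_of_mem _ hp)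
    have hz := TS_sign_zero hs
    generalize p.coeff 0 = c at *
    subst hpc
    simp only [Polynomial.map_C, Polynomial.eval_C, ne_eq, Polynomial.C_eq_zero]
    exact ⟨hz, fun _ _ _ => hs, fun h _ h' => absurd h' h, fun h _ h' => absurd h' h⟩
  | succ D ihD =>
    intro k
    induction k with
    | zero =>
      intro F hF hc
      refine ihD _ F (fun p hp => ?_) le_rfl
      have h1 := hF p hp
      rw [Nat.le_zero, Finset.card_eq_zero, Finset.filter_eq_empty_iff] at hc
      have := hc hp
      omega
    | succ k ihk =>
      intro F hF hc
      by_cases hex : ∃ p ∈ F, p.natDegree = D + 1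
      swap
      · push Not at hex
        refine ihk F hF ?_
        rw [Finset.card_eq_zero.2 (Finset.filter_eq_empty_iff.2 fun p hp => hex p hp)]
        exact Nat.zero_le _
      obtain ⟨p, hp, hpd⟩ := hex
      set Rm : R[X] → ℕ → R[X] := fun q j =>
        C (q.coeff j) * p.eraseLead - C p.leadingCoeff *
          ∑ i ∈ Finset.range j, C (q.coeff i) * X ^ (i + (D + 1 - j)) with hRm
      set Fp : Finset R[X] := insert p.derivative (insert p.eraseLead (F.erase p)) with hFp
      set F' : Finset R[X] := Fp ∪ Fp.biUnion (fun q => (Finset.range (D + 2)).image (Rm q)) with hF'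
      have hder : p.derivative.natDegree ≤ D := by
        have := Polynomial.natDegree_derivative_le p; omega
      have her : p.eraseLead.natDegree ≤ D := by
        have := Polynomial.eraseLead_natDegree_le p; omega
      have hRmd : ∀ q j, j < D + 2 → (Rm q j).natDegree ≤ D := by
        intro q j hj
        refine (Polynomial.natDegree_sub_le _ _).trans (max_le ?_ ?_)
        · exact (Polynomial.natDegree_C_mul_le _ _).trans her
        · refine (Polynomial.natDegree_C_mul_le _ _).trans ?_
          refine Polynomial.natDegree_sum_le_of_forall_le _ _ fun i hi => ?_
          refine (Polynomial.natDegree_C_mul_X_pow_le _ _).trans ?_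
          have := Finset.mem_range.1 hi
          omega
      have hFpd : ∀ q ∈ Fp, q.natDegree ≤ D + 1 := by
        intro q hq
        simp only [hFp, Finset.mem_insert, Finset.mem_erase] at hq
        rcases hq with rfl | rfl | hq
        · omega
        · omega
        · exact hF q hq.2
      have hnew : ∀ q ∈ F', q.natDegree ≤ D ∨ q ∈ F.erase p := by
        intro q hq
        simp only [hF', Finset.mem_union, Finset.mem_biUnion, Finset.mem_image,
          Finset.mem_range] at hq
        rcases hq with hq | ⟨r, _, j, hj, rfl⟩
        · simp only [hFp, Finset.mem_insert] at hq
          rcases hq with rfl | rfl | hq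
          · exact Or.inl hder
          · exact Or.inl her
          · exact Or.inr hq
        · exact Or.inl (hRmd r j hj)
      obtain ⟨C', hC'⟩ := ihk F' (by
          intro q hq
          rcases hnew q hq with h | h
          · omega
          · exact hF q (Finset.mem_of_mem_erase h)) (by
          have hsub : ({q ∈ F' | q.natDegree = D + 1}) ⊆ ({q ∈ F | q.natDegree = D + 1}).erase p := by
            intro q hq
            rw [Finset.mem_filter] at hq
            rcases hnew q hq.1 with h | h
            · omega
            · rw [Finset.mem_erase] at h ⊢
              exact ⟨h.1, Finset.mem_filter.2 ⟨h.2, hq.2⟩⟩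
          have h1 := Finset.card_le_card hsub
          rw [Finset.card_erase_of_mem (Finset.mem_filter.2 ⟨hp, hpd⟩)] at h1
          omega)
      refine ⟨insert p.leadingCoeff (C' ∪ Fp.biUnion (fun q => (Finset.range (D + 2)).image q.coeff)),
        fun α β hC => ?_⟩
      obtain ⟨Z0, hZ0⟩ := hC' α β (fun c hc => hC c (by simp [hc]))
      have hlc := hC p.leadingCoeff (by simp)
      have hcoef : ∀ q ∈ Fp, ∀ j, SignType.sign (α (q.coeff j)) = SignType.sign (β (q.coeff j)) := by
        intro q hq j
        by_cases hj : j < D + 2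
        · refine hC _ (Finset.mem_insert_of_mem (Finset.mem_union_right _ ?_))
          exact Finset.mem_biUnion.2 ⟨q, hq, Finset.mem_image.2 ⟨j, Finset.mem_range.2 hj, rfl⟩⟩
        · rw [Polynomial.coeff_eq_zero_of_natDegree_lt (by have := hFpd q hq; omega)]
          simp
      obtain ⟨Z, hZZ, hZ⟩ := TS_restrict (G := TSPairs Fp α β) (by
        rintro f ⟨q, hq, rfl⟩
        exact ⟨q, Finset.mem_union_left _ hq, rfl⟩) hZ0
      by_cases hα : α p.leadingCoeff = 0
      · have hβ := (TS_sign_zero hlc).1 hα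
        have hmap : ∀ γ : R →+* ℝ, γ p.leadingCoeff = 0 → p.map γ = p.eraseLead.map γ := by
          intro γ hγ
          conv_lhs => rw [← Polynomial.eraseLead_add_C_mul_X_pow p]
          rw [Polynomial.map_add]
          simp [hγ]
        obtain ⟨Z', -, hZ'⟩ := TS_restrict (G := TSPairs F α β) (by
          rintro f ⟨q, hq, rfl⟩
          by_cases hqp : q = p
          · subst hqp
            exact ⟨q.eraseLead, by simp [hFp], by rw [hmap α hα, hmap β hβ]⟩
          · exact ⟨q, by simp [hFp, hqp, hq], rfl⟩) hZ
        exact ⟨Z', hZ'⟩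
      · have hβ : β p.leadingCoeff ≠ 0 := fun h => hα ((TS_sign_zero hlc).2 h)
        have hdne : ∀ γ : R →+* ℝ, γ p.leadingCoeff ≠ 0 → (p.map γ).derivative ≠ 0 := by
          intro γ hγ h0
          have h1 := congrArg (fun r => Polynomial.coeff r D) h0
          simp only [Polynomial.coeff_derivative, Polynomial.coeff_map, Polynomial.coeff_zero] at h1
          rw [← hpd] at h1
          have h2 : ((D : ℝ) + 1) ≠ 0 := by positivity
          exact (mul_ne_zero hγ h2) h1
        obtain ⟨Z1, hZ1⟩ := TS_step hZ (p.map α) (p.map β) ⟨p.derivative, by simp [hFp], by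
          simp [Polynomial.derivative_map]⟩ (hdne α hα) (hdne β hβ) (by
          intro z hz
          obtain ⟨f, ⟨q, hq, rfl⟩, hf0, hfz⟩ := hZ.2.1 z hz
          simp only at hf0 hfz
          have hqz := (hZ.2.2 _ ⟨q, hq, rfl⟩).2.1 _ _ (hZ.1 z hz)
          simp only at hqz
          have hfz2 := (TS_sign_zero hqz).1 hfz
          set j := (q.map α).natDegree with hj
          have hjD : j ≤ D + 1 := Polynomial.natDegree_map_le.trans (hFpd q hq)
          have hjα : ∀ i, j < i → α (q.coeff i) = 0 := by
            intro i hi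
            have := Polynomial.coeff_eq_zero_of_natDegree_lt hi
            rwa [Polynomial.coeff_map] at this
          have hjβ : ∀ i, j < i → β (q.coeff i) = 0 := fun i hi =>
            (TS_sign_zero (hcoef q hq i)).1 (hjα i hi)
          have hjne : α (q.coeff j) ≠ 0 := by
            have := Polynomial.leadingCoeff_ne_zero.2 hf0
            rwa [Polynomial.leadingCoeff, Polynomial.coeff_map] at this
          have e1 := TS_rem_eval α p q (D + 1) j hpd hjD hjα z.1 hfz
          have e2 := TS_rem_eval β p q (D + 1) j hpd hjD hjβ z.2 hfz2
          have hmem : Rm q j ∈ F' := by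
            refine Finset.mem_union_right _ (Finset.mem_biUnion.2 ⟨q, hq, Finset.mem_image.2
              ⟨j, Finset.mem_range.2 (by omega), rfl⟩⟩)
          have e3 := (hZ0.2.2 _ ⟨Rm q j, hmem, rfl⟩).2.1 _ _ (hZ0.1 z (hZZ hz))
          simp only [hRm] at e3
          rw [e1, e2, sign_mul, sign_mul, ← hcoef q hq j] at e3
          exact mul_left_cancel₀ (by simpa using hjne) e3)
        obtain ⟨Z', -, hZ'⟩ := TS_restrict (G := TSPairs F α β) (by
          rintro f ⟨q, hq, rfl⟩
          by_cases hqp : q = p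
          · subst hqp
            exact Set.mem_insert _ _
          · exact Set.mem_insert_of_mem _ ⟨q, by simp [hFp, hqp, hq], rfl⟩) hZ1
        exact ⟨Z', hZ'⟩

open Polynomial in
/-- Tarski's theorem in one variable: the signs of finitely many coefficients expressions
determine which sign vectors are realised by a finite family. -/
theorem TS_tarski {R : Type*} [CommRing R] (F : Finset R[X]) :
    ∃ C : Finset R, ∀ α β : R →+* ℝ,
      (∀ c ∈ C, SignType.sign (α c) = SignType.sign (β c)) →
      ∀ x, ∃ y, ∀ p ∈ F, SignType.sign ((p.map α).eval x) = SignType.sign ((p.map β).eval y) := by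
  obtain ⟨C, hC⟩ := TS_main (F.sup Polynomial.natDegree) _ F
    (fun p hp => Finset.le_sup (f := Polynomial.natDegree) hp) le_rfl
  refine ⟨C, fun α β h x => ?_⟩
  obtain ⟨Z, h1, _, h3⟩ := hC α β h
  obtain ⟨y, hy⟩ := TS_exists_compat h1 x
  exact ⟨y, fun p hp => (h3 _ ⟨p, hp, rfl⟩).2.1 x y hy⟩

/-- sign-determined sets: equivalent to being semialgebraic -/
def TSSA {σ : Type} (S : Set (σ → ℝ)) : Prop :=
  ∃ C : Finset (MvPolynomial σ ℝ), ∀ a b : σ → ℝ,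
    (∀ c ∈ C, SignType.sign (MvPolynomial.eval a c) = SignType.sign (MvPolynomial.eval b c)) →
    a ∈ S → b ∈ S

theorem TSSA_of {n : ℕ} {S : Set (Fin n → ℝ)} (h : IsSemialgebraic S) : TSSA S := by
  classical
  obtain ⟨m, p, Q, rfl⟩ := h
  refine ⟨Finset.univ.image p ∪ Finset.univ.biUnion Q, fun a b hab ha => ?_⟩
  obtain ⟨i, h1, h2⟩ := Set.mem_iUnion.1 ha
  refine Set.mem_iUnion.2 ⟨i, ?_, fun q hq => ?_⟩
  · exact (TS_sign_zero (hab (p i) (by simp))).1 h1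
  · have := hab q (Finset.mem_union_right _ (Finset.mem_biUnion.2 ⟨i, Finset.mem_univ _, hq⟩))
    rw [sign_pos (h2 q hq)] at this
    exact sign_eq_one_iff.1 this.symm

theorem TSSA_to {n : ℕ} {S : Set (Fin n → ℝ)} (h : TSSA S) : IsSemialgebraic S := by
  classical
  obtain ⟨C, hC⟩ := h
  let T := {s : C → SignType // ∃ a ∈ S, ∀ c : C, SignType.sign (MvPolynomial.eval a c.1) = s c}
  haveI : Fintype T := Fintype.ofFinite T
  let e := Fintype.equivFin T
  refine ⟨Fintype.card T,
    fun i => ∑ c : C, if (e.symm i).1 c = 0 then c.1 ^ 2 else 0,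
    fun i => (Finset.univ.filter (fun c : C => (e.symm i).1 c ≠ 0)).image
      (fun c => if (e.symm i).1 c = 1 then c.1 else -c.1), ?_⟩
  ext x
  simp only [Set.mem_iUnion, Set.mem_setOf_eq]
  constructor
  · intro hx
    refine ⟨e ⟨fun c => SignType.sign (MvPolynomial.eval x c.1), x, hx, fun c => rfl⟩, ?_, ?_⟩
    · simp only [Equiv.symm_apply_apply, map_sum]
      refine Finset.sum_eq_zero fun c _ => ?_
      split_ifs with h
      · simp [sign_eq_zero_iff.1 h]
      · simp
    · intro q hq
      simp only [Equiv.symm_apply_apply, Finset.mem_image, Finset.mem_filter] at hq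
      obtain ⟨c, ⟨_, hc⟩, rfl⟩ := hq
      split_ifs with h
      · exact sign_eq_one_iff.1 h
      · rw [map_neg, neg_pos]
        rcases lt_trichotomy (MvPolynomial.eval x c.1) 0 with h' | h' | h'
        · exact h'
        · exact absurd (by rw [h', sign_zero]) hc
        · exact absurd (sign_pos h') h
  · rintro ⟨i, h1, h2⟩
    obtain ⟨a, ha, has⟩ := (e.symm i).2
    refine hC a x (fun c hc => ?_) ha
    rw [has ⟨c, hc⟩]
    rw [map_sum, Finset.sum_eq_zero_iff_of_nonneg (by
      intro c _
      split_ifs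
      · rw [map_pow]; positivity
      · simp)] at h1
    have h1' := h1 ⟨c, hc⟩ (Finset.mem_univ _)
    by_cases h0 : (e.symm i).1 ⟨c, hc⟩ = 0
    · rw [if_pos h0] at h1'
      simp only [map_pow] at h1'
      rw [h0, pow_eq_zero_iff two_ne_zero |>.1 h1', sign_zero]
    · have h2' := h2 _ (Finset.mem_image.2 ⟨⟨c, hc⟩, Finset.mem_filter.2 ⟨Finset.mem_univ _, h0⟩, rfl⟩)
      split_ifs at h2' with h
      · rw [h, sign_pos h2']
      · simp only [map_neg, neg_pos] at h2'
        rw [sign_neg h2']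
        generalize (e.symm i).1 ⟨c, hc⟩ = s at *
        revert h0 h
        cases s <;> decide

theorem TSSA_inter {σ : Type} {S T : Set (σ → ℝ)} (hS : TSSA S) (hT : TSSA T) : TSSA (S ∩ T) := by
  classical
  obtain ⟨C, hC⟩ := hS
  obtain ⟨D, hD⟩ := hT
  exact ⟨C ∪ D, fun a b h ⟨h1, h2⟩ =>
    ⟨hC a b (fun c hc => h c (Finset.mem_union_left _ hc)) h1,
     hD a b (fun c hc => h c (Finset.mem_union_right _ hc)) h2⟩⟩

theorem TSSA_compl {σ : Type} {S : Set (σ → ℝ)} (hS : TSSA S) : TSSA Sᶜ := by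
  obtain ⟨C, hC⟩ := hS
  exact ⟨C, fun a b h ha hb => ha (hC b a (fun c hc => (h c hc).symm) hb)⟩

theorem TSSA_univ {σ : Type} : TSSA (Set.univ : Set (σ → ℝ)) :=
  ⟨∅, fun _ _ _ _ => trivial⟩

theorem TSSA_iInter {σ ι : Type} [Finite ι] {S : ι → Set (σ → ℝ)} (h : ∀ i, TSSA (S i)) :
    TSSA (⋂ i, S i) := by
  classical
  haveI := Fintype.ofFinite ι
  choose C hC using h
  refine ⟨Finset.univ.biUnion C, fun a b hab ha => Set.mem_iInter.2 fun i =>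
    hC i a b (fun c hc => hab c (Finset.mem_biUnion.2 ⟨i, Finset.mem_univ _, hc⟩))
      (Set.mem_iInter.1 ha i)⟩

/-- preimage under a coordinate map -/
theorem TSSA_comap {σ τ : Type} {S : Set (σ → ℝ)} (hS : TSSA S) (e : σ → τ) :
    TSSA {v : τ → ℝ | (fun i => v (e i)) ∈ S} := by
  classical
  obtain ⟨C, hC⟩ := hS
  refine ⟨C.image (MvPolynomial.rename e), fun a b h ha => hC _ _ (fun c hc => ?_) ha⟩
  have := h _ (Finset.mem_image_of_mem _ hc)
  rw [MvPolynomial.eval_rename, MvPolynomial.eval_rename] at this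
  exact this

theorem TSSA_eq {σ : Type} (i j : σ) : TSSA {v : σ → ℝ | v i = v j} := by
  refine ⟨{MvPolynomial.X i - MvPolynomial.X j}, fun a b h ha => ?_⟩
  have := TS_sign_zero (h _ (Finset.mem_singleton_self _))
  simp only [map_sub, MvPolynomial.eval_X, sub_eq_zero] at this
  exact this.1 ha

theorem TS_eval_option {σ : Type} (x : σ → ℝ) (t : ℝ) (c : MvPolynomial (Option σ) ℝ) :
    ((MvPolynomial.optionEquivLeft ℝ σ c).map (MvPolynomial.eval x)).eval t =
      MvPolynomial.eval (fun o => o.elim t x) c := by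
  induction c using MvPolynomial.induction_on with
  | C a => simp
  | add p q hp hq => simp [hp, hq]
  | mul_X p i hp =>
    simp only [map_mul, Polynomial.map_mul, Polynomial.eval_mul, hp, MvPolynomial.eval_X]
    cases i <;> simp

theorem TSSA_exists {σ : Type} {S : Set (Option σ → ℝ)} (hS : TSSA S) :
    TSSA {x : σ → ℝ | ∃ t : ℝ, (fun o : Option σ => o.elim t x) ∈ S} := by
  classical
  obtain ⟨C, hC⟩ := hS
  obtain ⟨D, hD⟩ := TS_tarski (C.image (MvPolynomial.optionEquivLeft ℝ σ))
  refine ⟨D, fun a b hab ⟨t, ht⟩ => ?_⟩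
  obtain ⟨s, hs⟩ := hD (MvPolynomial.eval a) (MvPolynomial.eval b) hab t
  refine ⟨s, hC _ _ (fun c hc => ?_) ht⟩
  have := hs _ (Finset.mem_image_of_mem _ hc)
  rwa [TS_eval_option, TS_eval_option] at this

theorem TSSA_exists_fin {σ : Type} (m : ℕ) : ∀ {S : Set (σ ⊕ Fin m → ℝ)}, TSSA S →
    TSSA {x : σ → ℝ | ∃ y : Fin m → ℝ, Sum.elim x y ∈ S} := by
  induction m with
  | zero =>
    intro S hS
    have := TSSA_comap hS (τ := σ) (Sum.elim id (fun i : Fin 0 => i.elim0))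
    convert this using 1
    ext x
    constructor
    · rintro ⟨y, hy⟩
      show _ ∈ S
      convert hy using 1
      funext i
      rcases i with i | i
      · rfl
      · exact i.elim0
    · intro h
      refine ⟨fun i => i.elim0, ?_⟩
      have h : _ ∈ S := h
      convert h using 1
      funext i
      rcases i with i | i
      · rfl
      · exact i.elim0
  | succ m ih =>
    intro S hS
    let e : σ ⊕ Fin (m + 1) → Option (σ ⊕ Fin m) :=
      Sum.elim (fun i => some (Sum.inl i)) (Fin.cons none (fun j => some (Sum.inr j)))
    have h1 := ih (TSSA_exists (TSSA_comap hS e))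
    convert h1 using 1
    ext x
    have key : ∀ (y : Fin m → ℝ) (t : ℝ),
        (fun i => (fun o : Option (σ ⊕ Fin m) => o.elim t (Sum.elim x y)) (e i))
          = Sum.elim x (Fin.cons t y : Fin (m + 1) → ℝ) := by
      intro y t
      funext i
      rcases i with i | i
      · rfl
      · refine Fin.cases ?_ (fun j => ?_) i <;> simp [e]
    constructor
    · rintro ⟨y, hy⟩
      refine ⟨Fin.tail y, y 0, ?_⟩
      show _ ∈ S
      rw [key, Fin.cons_self_tail]
      exact hy
    · rintro ⟨y, t, h⟩
      refine ⟨Fin.cons t y, ?_⟩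
      rw [← key]
      exact h

theorem TS_comp {n m : ℕ} {U : Set (Fin n → ℝ)} {g : (Fin n → ℝ) → (Fin m → ℝ)}
    {V : Set (Fin m → ℝ)} {f : (Fin m → ℝ) → ℝ} {W : Set (Fin n → ℝ)}
    (hU : IsOpen U) (hV : IsOpen V) (hVs : IsSemialgebraic V)
    (hW : IsOpen W) (hWs : IsSemialgebraic W)
    (hg : IsNashMap U g) (hf : IsNashFun V f) :
    IsOpen (U ∩ g ⁻¹' V ∩ W) ∧ IsSemialgebraic (U ∩ g ⁻¹' V ∩ W) ∧
      IsNashFun (U ∩ g ⁻¹' V ∩ W) (f ∘ g) := by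
  have hVt := TSSA_of hVs
  have hWt := TSSA_of hWs
  have hG := TSSA_of hg.2
  have hF := TSSA_of hf.2
  refine ⟨(hg.1.continuousOn.isOpen_inter_preimage hU hV).inter hW, TSSA_to (TSSA_inter ?_ hWt),
    (hf.1.comp (hg.1.mono ?_) ?_), TSSA_to ?_⟩
  · have h1 := TSSA_comap hG (τ := Fin n ⊕ Fin m) (Fin.addCases Sum.inl Sum.inr)
    have h2 := TSSA_comap hVt (τ := Fin n ⊕ Fin m) Sum.inr
    have h3 := TSSA_exists_fin m (TSSA_inter h1 h2)
    convert h3 using 1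
    ext x
    simp only [Set.mem_inter_iff, Set.mem_preimage, Set.mem_setOf_eq, Fin.addCases_left,
      Fin.addCases_right, Sum.elim_inl, Sum.elim_inr]
    constructor
    · rintro ⟨hx, hgx⟩
      exact ⟨g x, ⟨hx, fun _ => rfl⟩, hgx⟩
    · rintro ⟨y, ⟨hx, hy⟩, hyV⟩
      have : g x = y := funext hy
      exact ⟨hx, by rw [this]; exact hyV⟩
  · exact fun x hx => hx.1.1
  · exact fun x hx => hx.1.2
  · have h1 := TSSA_comap hG (τ := Fin (n + 1) ⊕ Fin m)
      (Fin.addCases (fun i => Sum.inl (Fin.castAdd 1 i)) Sum.inr)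
    have h2 := TSSA_comap hF (τ := Fin (n + 1) ⊕ Fin m)
      (Fin.addCases Sum.inr (fun i => Sum.inl (Fin.natAdd n i)))
    have h4 := TSSA_comap hWt (τ := Fin (n + 1)) (Fin.castAdd 1)
    have h3 := TSSA_inter (TSSA_exists_fin m (TSSA_inter h1 h2)) h4
    convert h3 using 1
    ext x
    simp only [Set.mem_inter_iff, Set.mem_preimage, Set.mem_setOf_eq, Fin.addCases_left,
      Fin.addCases_right, Sum.elim_inl, Sum.elim_inr, Function.comp]
    constructor
    · rintro ⟨⟨⟨hx, hgx⟩, hw⟩, hfx⟩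
      exact ⟨⟨_, ⟨hx, fun _ => rfl⟩, hgx, hfx⟩, hw⟩
    · rintro ⟨⟨y, ⟨hx, hy⟩, hyV, hfy⟩, hw⟩
      obtain rfl : g _ = y := funext hy
      exact ⟨⟨⟨hx, hyV⟩, hw⟩, hfy⟩

theorem TS_coord {m : ℕ} (j : Fin m) : IsNashFun (Set.univ : Set (Fin m → ℝ)) (fun y => y j) := by
  refine ⟨(contDiff_apply ℝ ℝ j).contDiffOn, TSSA_to ?_⟩
  simpa using TSSA_eq (Fin.castAdd 1 j) (Fin.natAdd m 0)

theorem TS_nash_pi {n m : ℕ} {V : Fin m → Set (Fin n → ℝ)} {g : Fin m → (Fin n → ℝ) → ℝ}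
    (hVs : ∀ j, IsSemialgebraic (V j)) (hg : ∀ j, IsNashFun (V j) (g j)) :
    IsSemialgebraic (⋂ j, V j) ∧ IsNashMap (⋂ j, V j) (fun x j => g j x) := by
  have hI : TSSA (⋂ j, V j) := TSSA_iInter fun j => TSSA_of (hVs j)
  refine ⟨TSSA_to hI, contDiffOn_pi.2 fun j => (hg j).1.mono (Set.iInter_subset _ j), TSSA_to ?_⟩
  have h1 := TSSA_inter (TSSA_comap hI (τ := Fin (n + m)) (Fin.castAdd m))
    (TSSA_iInter fun j => TSSA_comap (TSSA_of (hg j).2) (τ := Fin (n + m))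
      (Fin.addCases (Fin.castAdd m) (fun _ => Fin.natAdd n j)))
  convert h1 using 1
  ext x
  simp only [Set.mem_inter_iff, Set.mem_setOf_eq, Set.mem_iInter, Fin.addCases_left,
      Fin.addCases_right]
  constructor
  · rintro ⟨h1, h2⟩
    exact ⟨h1, fun j => ⟨h1 j, h2 j⟩⟩
  · rintro ⟨h1, h2⟩
    exact ⟨h1, fun j => (h2 j).2⟩

/-- For closed semialgebraic `X ⊆ ℝⁿ`, `Y ⊆ ℝ^m` and continuous `φ : X → Y`:
`φ` pulls back QN functions to QN functions iff there is a finite cover of `X` by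
relatively open semialgebraic subsets on which `φ` restricts to an NQN map. -/
theorem stmt_9 {n m : ℕ} (X : Set (Fin n → ℝ)) (Y : Set (Fin m → ℝ))
    (hXsa : IsSemialgebraic X) (hXcl : IsClosed X)
    (hYsa : IsSemialgebraic Y) (hYcl : IsClosed Y)
    (φ : (Fin n → ℝ) → (Fin m → ℝ))
    (hmap : Set.MapsTo φ X Y) (hcont : ContinuousOn φ X) :
    (∀ U : Set (Fin m → ℝ), U ⊆ Y → IsSemialgebraic U →
        (∃ V, IsOpen V ∧ U = V ∩ Y) →
        ∀ f : (Fin m → ℝ) → ℝ, IsQNFunOn Y U f →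
          IsQNFunOn X (X ∩ φ ⁻¹' U) (f ∘ φ)) ↔
    (∃ (N : ℕ) (Xp : Fin N → Set (Fin n → ℝ)),
        (∀ i, IsSemialgebraic (Xp i)) ∧
        (∀ i, ∃ V, IsOpen V ∧ Xp i = V ∩ X) ∧
        (⋃ i, Xp i) = X ∧
        ∀ i, IsNQNMap (Xp i) φ) := by
  classical
  constructor
  · intro h
    have h1 : ∀ j : Fin m, IsQNFunOn X (X ∩ φ ⁻¹' Y) ((fun y : Fin m → ℝ => y j) ∘ φ) := by
      intro j
      refine h Y subset_rfl hYsa ⟨Set.univ, isOpen_univ, by simp⟩ _ ?_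
      exact ⟨1, fun _ => Set.univ, fun _ y => y j, fun _ => isOpen_univ,
        fun _ => TSSA_to TSSA_univ, fun _ => TS_coord j, by simp [Set.iUnion_const],
        fun _ _ _ => rfl⟩
    have hXY : X ∩ φ ⁻¹' Y = X := Set.inter_eq_left.2 hmap
    rw [hXY] at h1
    choose M V g hVo hVs hg hcov hag using h1
    let e := Fintype.equivFin ((j : Fin m) → Fin (M j))
    have hns : ∀ k : (j : Fin m) → Fin (M j), _ := fun k =>
      TS_nash_pi (V := fun j => V j (k j)) (g := fun j => g j (k j))
        (fun j => hVs j (k j)) (fun j => hg j (k j))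
    have hopen : ∀ k : (j : Fin m) → Fin (M j), IsOpen (⋂ j, V j (k j)) := fun k =>
      isOpen_iInter_of_finite fun j => hVo j (k j)
    refine ⟨_, fun i => (⋂ j, V j (e.symm i j)) ∩ X, fun i => ?_, fun i => ?_, ?_, fun i => ?_⟩
    · exact TSSA_to (TSSA_inter (TSSA_of (hns _).1) (TSSA_of hXsa))
    · exact ⟨_, hopen _, rfl⟩
    · apply Set.Subset.antisymm
      · exact Set.iUnion_subset fun i => Set.inter_subset_right
      · intro x hx
        have : ∀ j, ∃ k, x ∈ V j k := by
          intro j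
          have hx' := hx
          rw [← hcov j] at hx'
          obtain ⟨k, hk⟩ := Set.mem_iUnion.1 hx'
          exact ⟨k, hk.1⟩
        choose k hk using this
        refine Set.mem_iUnion.2 ⟨e k, ?_, hx⟩
        simpa using hk
    · refine ⟨⋂ j, V j (e.symm i j), hopen _, (hns _).1, Set.inter_subset_left, ?_,
        _, (hns _).2, ?_⟩
      · have : (Subtype.val ⁻¹' ((⋂ j, V j (e.symm i j)) ∩ X) : Set ↥(⋂ j, V j (e.symm i j)))
            = Subtype.val ⁻¹' X := by
          ext x
          simp only [Set.mem_preimage, Set.mem_inter_iff]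
          exact ⟨fun h => h.2, fun h => ⟨x.2, h⟩⟩
        rw [this]
        exact hXcl.preimage continuous_subtype_val
      · intro x hx
        funext j
        exact (hag j _ x ⟨Set.mem_iInter.1 hx.1 j, hx.2⟩).symm
  · rintro ⟨N, Xp, hXps, hXpo, hXcov, hNQN⟩ U hUY hUs hUo f ⟨M, V, fV, hVo, hVs, hfV, hVcov, hfag⟩
    choose O hO hOX using hXpo
    choose A hAo hAs hXA _ g hg hgφ using hNQN
    have hWeq : ∀ i, (X \ Xp i)ᶜ = O i ∪ Xᶜ := by
      intro i
      rw [hOX i]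
      ext x
      simp only [Set.mem_compl_iff, Set.mem_diff, Set.mem_inter_iff, Set.mem_union]
      tauto
    have hWo : ∀ i, IsOpen (X \ Xp i)ᶜ := fun i => by
      rw [hWeq]; exact (hO i).union hXcl.isOpen_compl
    have hWs : ∀ i, IsSemialgebraic (X \ Xp i)ᶜ := fun i =>
      TSSA_to (TSSA_compl (TSSA_inter (TSSA_of hXsa) (TSSA_compl (TSSA_of (hXps i)))))
    let e := Fintype.equivFin (Fin N × Fin M)
    have hc : ∀ k : Fin N × Fin M, _ := fun k =>
      TS_comp (hAo k.1) (hVo k.2) (hVs k.2) (hWo k.1) (hWs k.1) (hg k.1) (hfV k.2)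
    have hmemX : ∀ i x, x ∈ (X \ Xp i)ᶜ → x ∈ X → x ∈ Xp i := by
      intro i x hx hxX
      by_contra hn
      exact hx ⟨hxX, hn⟩
    refine ⟨_, fun l => A (e.symm l).1 ∩ g (e.symm l).1 ⁻¹' V (e.symm l).2 ∩ (X \ Xp (e.symm l).1)ᶜ,
      fun l => fV (e.symm l).2 ∘ g (e.symm l).1, fun l => (hc _).1, fun l => (hc _).2.1,
      fun l => (hc _).2.2, ?_, ?_⟩
    · ext x
      simp only [Set.mem_iUnion]
      constructor
      · rintro ⟨l, ⟨⟨hxA, hxV⟩, hxW⟩, hxX⟩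
        have hx := hmemX _ _ hxW hxX
        refine ⟨hxX, ?_⟩
        rw [Set.mem_preimage, hgφ _ x hx] at hxV
        rw [Set.mem_preimage, ← hVcov]
        exact Set.mem_iUnion.2 ⟨_, hxV, hmap hxX⟩
      · rintro ⟨hxX, hxU⟩
        have hx' := hxX
        rw [← hXcov] at hx'
        obtain ⟨i, hi⟩ := Set.mem_iUnion.1 hx'
        rw [Set.mem_preimage, ← hVcov] at hxU
        obtain ⟨j, hj⟩ := Set.mem_iUnion.1 hxU
        refine ⟨e (i, j), ?_⟩
        simp only [Equiv.symm_apply_apply]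
        refine ⟨⟨⟨hXA i hi, ?_⟩, fun h => h.2 hi⟩, hxX⟩
        rw [Set.mem_preimage, hgφ i x hi]
        exact hj.1
    · rintro l x ⟨⟨⟨hxA, hxV⟩, hxW⟩, hxX⟩
      have hx := hmemX _ _ hxW hxX
      rw [Set.mem_preimage] at hxV
      simp only [Function.comp]
      rw [hgφ _ x hx] at hxV ⊢
      exact hfag _ _ ⟨hxV, hmap hxX⟩
end

section
/- Let X ⊆ ℝ^n be a compact semialgebraic set and U ⊆ ℝ^n an open semialgebraic set with X ⊆ U. Then {φ|_X : φ ∈ 𝓢(ℝ^n), φ flat on ℝ^n \ U} = {F|_X : F is a C^∞ real-valued function on U}; that is, the Schwartz functions on X are exactly the restrictions to X of smooth functions on U. -/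
/-- A smooth function is flat at `z` if all its iterated derivatives (including the
value, `k = 0`) vanish at `z`. -/
def SmoothFlatAt {n : ℕ} (φ : (Fin n → ℝ) → ℝ) (z : Fin n → ℝ) : Prop :=
  ∀ k : ℕ, iteratedFDeriv ℝ k φ z = 0

/-- On a compact semialgebraic set `X` contained in an open semialgebraic `U`, the
Schwartz functions on `X` (restrictions of Schwartz functions on `ℝⁿ` flat on
`ℝⁿ \ U`) are exactly the restrictions to `X` of `C^∞` functions on `U`. -/
theorem stmt_12 {n : ℕ} (X : Set (Fin n → ℝ))
    (hXsa : IsSemialgebraic X) (hXcp : IsCompact X)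
    (U : Set (Fin n → ℝ)) (hUo : IsOpen U) (hUsa : IsSemialgebraic U) (hXU : X ⊆ U) :
    {h : ↥X → ℝ | ∃ φ : SchwartzMap ((Fin n) → ℝ) ℝ,
        (∀ z ∈ Uᶜ, SmoothFlatAt (⇑φ) z) ∧ ∀ x : ↥X, h x = φ x} =
    {h : ↥X → ℝ | ∃ F : (Fin n → ℝ) → ℝ,
        ContDiffOn ℝ (⊤ : ℕ∞) F U ∧ ∀ x : ↥X, h x = F x} := by
  ext h
  constructor
  · rintro ⟨φ, -, hφ⟩
    exact ⟨φ, (φ.smooth _).contDiffOn, hφ⟩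
  · rintro ⟨F, hF, hh⟩
    obtain ⟨K, hK, hXK, hKU⟩ := exists_compact_between hXcp hUo hXU
    obtain ⟨f, hf0, hf1, -⟩ := exists_contMDiffMap_zero_one_of_isClosed (n := (⊤ : ℕ∞))
      (modelWithCornersSelf ℝ (Fin n → ℝ)) (s := (interior K)ᶜ) (t := X)
      isOpen_interior.isClosed_compl hXcp.isClosed
      (Set.disjoint_left.2 fun x hx hx' => hx (hXK hx'))
    have hfs : ContDiff ℝ (⊤ : ℕ∞) f := f.contMDiff.contDiff
    have hsupp : Function.support (fun x => f x * F x) ⊆ K := by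
      intro x hx
      by_contra hxK
      have : f x = 0 := hf0 fun h' => hxK (interior_subset h')
      simp [this] at hx
    have hts : tsupport (fun x => f x * F x) ⊆ K := closure_minimal hsupp hK.isClosed
    have hc : HasCompactSupport (fun x => f x * F x) :=
      HasCompactSupport.of_support_subset_isCompact hK hsupp
    have hs : ContDiff ℝ (⊤ : ℕ∞) (fun x => f x * F x) := by
      rw [contDiff_iff_contDiffAt]
      intro x
      by_cases hx : x ∈ tsupport (fun x => f x * F x)
      swap
      · exact contDiffAt_const.congr_of_eventuallyEq (notMem_tsupport_iff_eventuallyEq.1 hx)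
      exact hfs.contDiffAt.mul (hF.contDiffAt (hUo.mem_nhds (hKU (hts hx))))
    refine ⟨hc.toSchwartzMap hs, ?_, ?_⟩
    · intro z hz k
      by_contra hne
      exact hz (hKU (hts (support_iteratedFDeriv_subset (𝕜 := ℝ) k hne)))
    · intro x
      have : f x = 1 := hf1 x.2
      change h x = f x * F x
      rw [this, one_mul, hh x]
end

section
/- (Proper refinement of semialgebraic covers.) Let M ⊆ ℝ^n be a closed semialgebraic set and let M = U_1 ∪ … ∪ U_k be a finite cover by relatively open semialgebraic subsets of M. Then there exists a finite cover M = V_1 ∪ … ∪ V_m by relatively open semialgebraic subsets of M such that for every j there exists i with the closure of V_j in M contained in U_i. -/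
namespace TS

open Polynomial

noncomputable section

/-- Local contribution of `G / F` at `0` to the Cauchy index. -/
def loc (G F : ℝ[X]) : ℤ :=
  if G.natTrailingDegree < F.natTrailingDegree ∧ Odd (F.natTrailingDegree + G.natTrailingDegree)
  then ((SignType.sign (F.trailingCoeff * G.trailingCoeff) : SignType) : ℤ) else 0

/-- Cauchy index of `g / f`. -/
def ind (g f : ℝ[X]) : ℤ := ∑ t ∈ f.roots.toFinset, loc (taylor t g) (taylor t f)

/-- Local sign jump of `H` at `0`. -/
def wt (H : ℝ[X]) : ℤ :=
  if Odd H.natTrailingDegree then ((SignType.sign H.trailingCoeff : SignType) : ℤ) else 0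

def tele (h : ℝ[X]) : ℤ := ∑ t ∈ h.roots.toFinset, wt (taylor t h)

lemma ntd_taylor_eq_zero {h : ℝ[X]} {t : ℝ} (ht : t ∉ h.roots.toFinset) :
    (taylor t h).natTrailingDegree = 0 := by
  rw [natTrailingDegree_eq_zero]
  by_cases h0 : h = 0
  · left; simp [h0]
  · right; rw [taylor_coeff_zero]; intro h1; apply ht; simp [h0, h1]

lemma ind_eq_sum {g f : ℝ[X]} {S : Finset ℝ} (hS : f.roots.toFinset ⊆ S) :
    ind g f = ∑ t ∈ S, loc (taylor t g) (taylor t f) := by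
  unfold ind
  refine Finset.sum_subset hS fun t _ ht => ?_
  simp [loc, ntd_taylor_eq_zero ht]

lemma tele_eq_sum {f : ℝ[X]} {S : Finset ℝ} (hS : f.roots.toFinset ⊆ S) :
    tele f = ∑ t ∈ S, wt (taylor t f) := by
  unfold tele
  refine Finset.sum_subset hS fun t _ ht => ?_
  simp [wt, ntd_taylor_eq_zero ht]

lemma loc_add_loc {F G : ℝ[X]} (hF : F ≠ 0) (hG : G ≠ 0) :
    loc G F + loc F G = wt (F * G) := by
  unfold loc wt
  rw [natTrailingDegree_mul hF hG, trailingCoeff_mul, mul_comm G.trailingCoeff,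
    add_comm G.natTrailingDegree]
  by_cases ho : Odd (F.natTrailingDegree + G.natTrailingDegree)
  · rcases lt_trichotomy F.natTrailingDegree G.natTrailingDegree with h | h | h
    · simp [ho, h, h.not_gt]
    · exfalso; rw [h] at ho; obtain ⟨r, hr⟩ := ho; omega
    · simp [ho, h, h.not_gt]
  · simp [ho]

lemma ind_add_ind {f g : ℝ[X]} (hf : f ≠ 0) (hg : g ≠ 0) :
    ind g f + ind f g = tele (f * g) := by
  have hfg : f * g ≠ 0 := mul_ne_zero hf hg
  have h1 : f.roots.toFinset ⊆ (f * g).roots.toFinset := by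
    intro t; simp [hf, hg]; tauto
  have h2 : g.roots.toFinset ⊆ (f * g).roots.toFinset := by
    intro t; simp [hf, hg]; tauto
  rw [ind_eq_sum h1, ind_eq_sum h2, tele, ← Finset.sum_add_distrib]
  refine Finset.sum_congr rfl fun t _ => ?_
  rw [taylor_mul, loc_add_loc] <;> simpa

lemma sign_eval_of_roots_lt {p : ℝ[X]} {t : ℝ} (h : ∀ y, p.IsRoot y → y < t) :
    SignType.sign (p.eval t) = SignType.sign p.leadingCoeff := by
  rcases le_total 0 p.leadingCoeff with h0 | h0
  · have := zero_lt_eval_of_roots_lt_of_leadingCoeff_nonneg h h0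
    have hp : p ≠ 0 := by rintro rfl; simp at this
    rw [sign_pos this, sign_pos (lt_of_le_of_ne h0 (leadingCoeff_ne_zero.2 hp).symm)]
  · have := eval_lt_zero_of_roots_lt_of_leadingCoeff_nonpos h h0
    have hp : p ≠ 0 := by rintro rfl; simp at this
    rw [sign_neg this, sign_neg (lt_of_le_of_ne h0 (by simpa using hp))]

lemma even_of_no_root {p : ℝ[X]} (hp : p ≠ 0) (h : ∀ y, ¬ p.IsRoot y) : Even p.natDegree := by
  by_contra ho
  rw [Nat.not_even_iff_odd] at ho
  have h1 := sign_eval_of_roots_lt (p := p) (t := 0) (fun y hy => (h y hy).elim)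
  have h2 := sign_eval_of_roots_lt (p := p.comp (-X)) (t := 0) (fun y hy => by
    exfalso; apply h (-y); simpa [IsRoot, eval_comp] using hy)
  have h3 : (p.comp (-X)).leadingCoeff = - p.leadingCoeff := by
    simp [ho.neg_one_pow]
  rw [h3, eval_comp] at h2
  simp only [eval_neg, eval_X, neg_zero] at h2
  rw [h1] at h2
  rw [Left.sign_neg] at h2
  have : SignType.sign p.leadingCoeff ≠ 0 := by simpa using hp
  revert h2 this
  generalize SignType.sign p.leadingCoeff = s
  revert s; decide

lemma trailing_of_eval_ne {q : ℝ[X]} {t : ℝ} (hq : q.eval t ≠ 0) :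
    (taylor t q).natTrailingDegree = 0 ∧ (taylor t q).trailingCoeff = q.eval t := by
  have : (taylor t q).natTrailingDegree = 0 := by
    rw [natTrailingDegree_eq_zero]; right; rwa [taylor_coeff_zero]
  refine ⟨this, ?_⟩
  rw [trailingCoeff, this, taylor_coeff_zero]

lemma exists_factor {h : ℝ[X]} (hh : h ≠ 0) (t : ℝ) :
    ∃ q : ℝ[X], ∃ m : ℕ, h = (X - C t) ^ m * q ∧ q.eval t ≠ 0 := by
  obtain ⟨q, hq, hd⟩ := exists_eq_pow_rootMultiplicity_mul_and_not_dvd h hh t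
  exact ⟨q, _, hq, by rwa [dvd_iff_isRoot] at hd⟩

lemma taylor_pow_mul (q : ℝ[X]) (t : ℝ) (m : ℕ) :
    taylor t ((X - C t) ^ m * q) = taylor t q * X ^ m := by
  rw [taylor_mul, taylor_pow, map_sub, taylor_X, taylor_C]; ring

lemma trailing_factor {q : ℝ[X]} {t : ℝ} (hq : q.eval t ≠ 0) (m : ℕ) :
    (taylor t ((X - C t) ^ m * q)).natTrailingDegree = m ∧
    (taylor t ((X - C t) ^ m * q)).trailingCoeff = q.eval t := by
  have h0 : taylor t q ≠ 0 := by
    intro h; apply hq; rw [← taylor_coeff_zero, h]; simp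
  rw [taylor_pow_mul, natTrailingDegree_mul_X_pow h0, trailingCoeff_mul,
    (trailing_of_eval_ne hq).1, (trailing_of_eval_ne hq).2]
  refine ⟨by simp, ?_⟩
  have : (X ^ m : ℝ[X]).trailingCoeff = 1 := by
    rw [trailingCoeff, natTrailingDegree_X_pow, coeff_X_pow_self]
  simp [this]

lemma sign_trailing_top {h : ℝ[X]} (hh : h ≠ 0) {t : ℝ} (ht : ∀ y, h.IsRoot y → y ≤ t) :
    SignType.sign (taylor t h).trailingCoeff = SignType.sign h.leadingCoeff := by
  obtain ⟨q, m, rfl, hq⟩ := exists_factor hh t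
  rw [(trailing_factor hq m).2, sign_eval_of_roots_lt]
  · simp [leadingCoeff_mul]
  · intro y hy
    refine lt_of_le_of_ne (ht y (by simp [IsRoot] at hy ⊢; simp [hy])) ?_
    rintro rfl; exact hq hy

lemma tele_step {h : ℝ[X]} (hh : h ≠ 0) {t : ℝ} (ht : ∀ y, h.IsRoot y → y ≤ t) :
    tele ((X - C t) * h) = (SignType.sign h.leadingCoeff : SignType) - tele h := by
  classical
  have hX : (X - C t) ≠ 0 := X_sub_C_ne_zero t
  have hr : ((X - C t) * h).roots.toFinset = insert t h.roots.toFinset := by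
    ext y; simp [hX, hh, sub_eq_zero]
  rw [tele_eq_sum hr.subset, tele_eq_sum (Finset.subset_insert t _), eq_sub_iff_add_eq,
    ← Finset.sum_add_distrib]
  rw [Finset.sum_eq_single_of_mem t (Finset.mem_insert_self _ _)]
  · rw [← sign_trailing_top hh ht]
    have h0 : taylor t h ≠ 0 := by simpa
    have h1 : taylor t ((X - C t) * h) = taylor t h * X ^ 1 := by
      rw [← taylor_pow_mul, pow_one]
    have h2 : (taylor t h * X ^ 1).trailingCoeff = (taylor t h).trailingCoeff := by
      rw [trailingCoeff_mul]; simp [trailingCoeff]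
    unfold wt
    rw [h1, natTrailingDegree_mul_X_pow h0, h2]
    by_cases ho : Odd (taylor t h).natTrailingDegree
    · simp [ho, Nat.odd_add_one]
    · simp [ho, Nat.odd_add_one]
  · intro y hy hne
    have hlt : y < t := by
      refine lt_of_le_of_ne ?_ hne
      rcases Finset.mem_insert.1 hy with h | h
      · exact h.le
      · apply ht; simpa [hh] using h
    have h0 : taylor y h ≠ 0 := by simpa
    have h1 : (X - C t).eval y ≠ 0 := by simp; linarith
    have h3 : taylor y (X - C t) ≠ 0 := by simpa [-map_sub] using hX
    unfold wt
    rw [taylor_mul, natTrailingDegree_mul h3 h0, trailingCoeff_mul, (trailing_of_eval_ne h1).1,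
      (trailing_of_eval_ne h1).2, sign_mul, sign_neg (by simp; linarith), zero_add]
    split_ifs <;> simp

lemma tele_eq (h : ℝ[X]) (hh : h ≠ 0) :
    tele h = if Odd h.natDegree then ((SignType.sign h.leadingCoeff : SignType) : ℤ) else 0 := by
  induction hn : h.natDegree generalizing h with
  | zero =>
    rw [natDegree_eq_zero] at hn
    obtain ⟨c, rfl⟩ := hn
    simp [tele]
  | succ n ih =>
    by_cases hr : ∃ y, h.IsRoot y
    · obtain ⟨y, hy⟩ := hr
      have hne : h.roots.toFinset.Nonempty := ⟨y, by simpa [hh] using hy⟩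
      obtain ⟨t, ht, hmax⟩ := h.roots.toFinset.exists_max_image id hne
      have htr : h.IsRoot t := by simpa [hh] using ht
      obtain ⟨q, rfl⟩ := dvd_iff_isRoot.2 htr
      have hq : q ≠ 0 := right_ne_zero_of_mul hh
      have hd : q.natDegree = n := by
        rw [natDegree_mul (X_sub_C_ne_zero t) hq, natDegree_X_sub_C] at hn; omega
      rw [tele_step hq, ih q hq hd]
      · rw [leadingCoeff_mul, leadingCoeff_X_sub_C, one_mul]
        by_cases ho : Odd n <;> simp [ho, Nat.odd_add_one]
      · intro y hy
        apply hmax y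
        have : eval y q = 0 := hy
        simp [this, hq, X_sub_C_ne_zero t]
    · push Not at hr
      have he := even_of_no_root hh hr
      rw [hn] at he
      have : tele h = 0 := by
        unfold tele
        apply Finset.sum_eq_zero
        intro y hy
        exact (hr y (by simpa [hh] using hy)).elim
      rw [this, if_neg (Nat.not_odd_iff_even.2 he)]

lemma loc_reduce {F G : ℝ[X]} {c : ℝ} (hc : c ≠ 0) (Q : ℝ[X]) :
    loc (C (c ^ 2) * G - Q * F) F = loc G F := by
  set R := C (c ^ 2) * G - Q * F with hR
  set m := F.natTrailingDegree with hm
  have hco : ∀ j < m, R.coeff j = c ^ 2 * G.coeff j := by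
    intro j hj
    have hz : (Q * F).coeff j = 0 := by
      rw [coeff_mul]
      apply Finset.sum_eq_zero
      rintro ⟨a, b⟩ hab
      rw [Finset.HasAntidiagonal.mem_antidiagonal] at hab
      simp only at hab ⊢
      rw [coeff_eq_zero_of_lt_natTrailingDegree (p := F) (by omega), mul_zero]
    rw [hR, coeff_sub, coeff_C_mul, hz, sub_zero]
  have key : ∀ H : ℝ[X], (∀ j < m, H.coeff j = 0) → loc H F = 0 := by
    intro H hH
    by_cases h0 : H = 0
    · simp [loc, h0]
    · have := le_natTrailingDegree h0 hH
      unfold loc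
      rw [if_neg]
      rintro ⟨h1, -⟩; omega
  by_cases hG : ∀ j < m, G.coeff j = 0
  · rw [key G hG, key R]
    intro j hj; rw [hco j hj, hG j hj, mul_zero]
  · push Not at hG
    obtain ⟨j, hj, hGj⟩ := hG
    have hGm : G.natTrailingDegree < m := (natTrailingDegree_le_of_ne_zero hGj).trans_lt hj
    have hG0 : G ≠ 0 := by rintro rfl; simp at hGj
    have hGc : G.coeff G.natTrailingDegree ≠ 0 := coeff_natTrailingDegree_ne_zero.2 hG0
    have hRc : R.coeff G.natTrailingDegree ≠ 0 := by
      rw [hco _ hGm]; positivity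
    have hR0 : R ≠ 0 := by intro h; rw [h] at hRc; simp at hRc
    have e : R.natTrailingDegree = G.natTrailingDegree := by
      apply le_antisymm (natTrailingDegree_le_of_ne_zero hRc)
      apply le_natTrailingDegree hR0
      intro i hi
      rw [hco i (hi.trans hGm), coeff_eq_zero_of_lt_natTrailingDegree hi, mul_zero]
    have e2 : R.trailingCoeff = c ^ 2 * G.trailingCoeff := by
      rw [trailingCoeff, e, hco _ hGm, trailingCoeff]
    have e3 : SignType.sign (F.trailingCoeff * (c ^ 2 * G.trailingCoeff)) =
        SignType.sign (F.trailingCoeff * G.trailingCoeff) := by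
      rw [sign_mul, sign_mul, sign_mul, sign_pos (show 0 < c ^ 2 by positivity), one_mul]
    unfold loc
    rw [e, e2, e3]

lemma ind_reduce (f g q : ℝ[X]) {c : ℝ} (hc : c ≠ 0) :
    ind (C (c ^ 2) * g - q * f) f = ind g f := by
  unfold ind
  refine Finset.sum_congr rfl fun t _ => ?_
  rw [map_sub, taylor_mul, taylor_mul, taylor_C, loc_reduce hc]

lemma loc_derivative {f : ℝ[X]} (hf : f ≠ 0) {t : ℝ} (ht : f.IsRoot t) (g : ℝ[X]) :
    loc (taylor t (derivative f * g)) (taylor t f) =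
      (SignType.sign (g.eval t) : SignType) := by
  obtain ⟨q, m, rfl, hq⟩ := exists_factor hf t
  obtain ⟨n, rfl⟩ : ∃ n, m = n + 1 := by
    refine Nat.exists_eq_succ_of_ne_zero ?_
    rintro rfl; simp [IsRoot] at ht; exact hq ht
  have hd : derivative ((X - C t) ^ (n + 1) * q) =
      (X - C t) ^ n * (C ((n : ℝ) + 1) * q + (X - C t) * derivative q) := by
    rw [derivative_mul, derivative_X_sub_C_pow]
    simp only [map_add, map_natCast, map_one, Nat.cast_add, Nat.cast_one, Nat.add_sub_cancel]
    ring
  by_cases hg : g = 0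
  · simp [hg, loc]
  obtain ⟨r, k, rfl, hr⟩ := exists_factor hg t
  set u := (C ((n : ℝ) + 1) * q + (X - C t) * derivative q) with hu
  have hut : (u * r).eval t = ((n : ℝ) + 1) * q.eval t * r.eval t := by simp [hu]
  have hn : (0 : ℝ) < n + 1 := by positivity
  have hut0 : (u * r).eval t ≠ 0 := by
    rw [hut]; exact mul_ne_zero (mul_ne_zero hn.ne' hq) hr
  have e : (X - C t) ^ n * u * ((X - C t) ^ k * r) = (X - C t) ^ (n + k) * (u * r) := by ring
  rw [hd, e]
  unfold loc
  rw [(trailing_factor hq _).1, (trailing_factor hq _).2, (trailing_factor hut0 _).1,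
    (trailing_factor hut0 _).2, hut]
  rcases Nat.eq_zero_or_pos k with rfl | hk
  · rw [if_pos ⟨by omega, ⟨n, by ring⟩⟩]
    have : q.eval t * (((n : ℝ) + 1) * q.eval t * r.eval t) =
      (((n : ℝ) + 1) * (q.eval t) ^ 2) * r.eval t := by ring
    rw [this, sign_mul, sign_pos (by positivity)]
    simp
  · rw [if_neg (by omega)]
    simp [hk.ne']

lemma ind_derivative {f : ℝ[X]} (hf : f ≠ 0) (g : ℝ[X]) :
    ind (derivative f * g) f =
      ∑ t ∈ f.roots.toFinset, ((SignType.sign (g.eval t) : SignType) : ℤ) := by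
  unfold ind
  refine Finset.sum_congr rfl fun t ht => ?_
  exact loc_derivative hf (by simpa [hf] using ht) g

open SignType in
/-- `N` depends only on the signs of finitely many polynomials. -/
def Det {σ α : Type} (N : (σ → ℝ) → α) : Prop :=
  ∃ F : Finset (MvPolynomial σ ℝ), ∀ x y : σ → ℝ,
    (∀ f ∈ F, sign (MvPolynomial.eval x f) = sign (MvPolynomial.eval y f)) → N x = N y

section det

variable {σ τ α β γ : Type}

lemma det_const (a : α) : Det (fun _ : σ → ℝ => a) := ⟨∅, fun _ _ _ => rfl⟩

lemma det_sign (f : MvPolynomial σ ℝ) : Det (fun x => SignType.sign (MvPolynomial.eval x f)) :=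
  ⟨{f}, fun _ _ h => h f (by simp)⟩

lemma Det.comp {N : (σ → ℝ) → α} (h : Det N) (φ : α → β) : Det (fun x => φ (N x)) := by
  obtain ⟨F, hF⟩ := h
  exact ⟨F, fun x y h => congrArg φ (hF x y h)⟩

lemma Det.comp₂ {N : (σ → ℝ) → α} {M : (σ → ℝ) → β} (h : Det N) (h' : Det M) (φ : α → β → γ) :
    Det (fun x => φ (N x) (M x)) := by
  classical
  obtain ⟨F, hF⟩ := h
  obtain ⟨G, hG⟩ := h'
  refine ⟨F ∪ G, fun x y h => ?_⟩
  show φ (N x) (M x) = φ (N y) (M y)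
  rw [hF x y fun f hf => h f (by simp [hf]), hG x y fun f hf => h f (by simp [hf])]

lemma Det.pi {ι : Type} {α : ι → Type} [Finite ι] {N : ∀ i, (σ → ℝ) → α i} (h : ∀ i, Det (N i)) :
    Det (fun x => fun i => N i x) := by
  classical
  cases nonempty_fintype ι
  choose F hF using h
  refine ⟨Finset.univ.biUnion F, fun x y h => ?_⟩
  funext i
  exact hF i x y fun f hf => h f (by simp; exact ⟨i, hf⟩)

lemma Det.and {P Q : (σ → ℝ) → Prop} (h : Det P) (h' : Det Q) : Det (fun x => P x ∧ Q x) :=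
  h.comp₂ h' And

lemma Det.or {P Q : (σ → ℝ) → Prop} (h : Det P) (h' : Det Q) : Det (fun x => P x ∨ Q x) :=
  h.comp₂ h' Or

lemma Det.not {P : (σ → ℝ) → Prop} (h : Det P) : Det (fun x => ¬ P x) := h.comp Not

lemma Det.all {ι : Type} [Finite ι] {P : ι → (σ → ℝ) → Prop} (h : ∀ i, Det (P i)) :
    Det (fun x => ∀ i, P i x) :=
  (Det.pi h).comp fun f => ∀ i, f i

lemma Det.ex {ι : Type} [Finite ι] {P : ι → (σ → ℝ) → Prop} (h : ∀ i, Det (P i)) :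
    Det (fun x => ∃ i, P i x) :=
  (Det.pi h).comp fun f => ∃ i, f i

lemma Det.ball {ι : Type} {s : Finset ι} {P : ι → (σ → ℝ) → Prop} (h : ∀ i ∈ s, Det (P i)) :
    Det (fun x => ∀ i ∈ s, P i x) := by
  have := Det.all (ι := s) (P := fun i => P i) (fun i => h i i.2)
  simpa using this

lemma Det.congr {N M : (σ → ℝ) → α} (h : Det N) (e : ∀ x, M x = N x) : Det M := by
  rwa [show M = N from funext e]

lemma det_zero (f : MvPolynomial σ ℝ) : Det (fun x => MvPolynomial.eval x f = 0) :=
  ((det_sign f).comp (fun s => s = 0)).congr fun x => by simp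

lemma det_pos (f : MvPolynomial σ ℝ) : Det (fun x => 0 < MvPolynomial.eval x f) :=
  ((det_sign f).comp (fun s => s = 1)).congr fun x => by simp [sign_eq_one_iff]

open Classical in
lemma Det.ite {P : (σ → ℝ) → Prop} {N M : (σ → ℝ) → α} (hP : Det P) (hN : Det N) (hM : Det M) :
    Det (fun x => if P x then N x else M x) :=
  hP.comp₂ (hN.comp₂ hM Prod.mk) fun p a => if p then a.1 else a.2

lemma Det.rename {N : (τ → ℝ) → α} (h : Det N) (e : τ → σ) : Det (fun x : σ → ℝ => N (x ∘ e)) := by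
  classical
  obtain ⟨F, hF⟩ := h
  refine ⟨F.image (MvPolynomial.rename e), fun x y h => hF _ _ fun f hf => ?_⟩
  have := h _ (Finset.mem_image_of_mem _ hf)
  simpa [MvPolynomial.eval_rename] using this

/-- specialization -/
abbrev sp (x : σ → ℝ) (f : (MvPolynomial σ ℝ)[X]) : ℝ[X] := f.map (MvPolynomial.eval x)

lemma det_sp_support (f : (MvPolynomial σ ℝ)[X]) :
    Det (fun x => fun i => SignType.sign ((sp x f).coeff i)) := by
  have h := Det.pi (ι := Fin (f.natDegree + 1)) (fun i => det_sign (f.coeff i))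
  refine (h.comp (fun s i => if hi : i < f.natDegree + 1 then s ⟨i, hi⟩ else 0)).congr fun x => ?_
  funext i
  split_ifs with hi
  · simp [coeff_map]
  · rw [coeff_map, coeff_eq_zero_of_natDegree_lt (by omega)]; simp

lemma det_sp_zero (f : (MvPolynomial σ ℝ)[X]) : Det (fun x => sp x f = 0) :=
  ((det_sp_support f).comp (fun s => s = 0)).congr fun x => by
    rw [Polynomial.ext_iff, funext_iff]; simp

lemma det_sp_lead (f : (MvPolynomial σ ℝ)[X]) :
    Det (fun x => 0 < (sp x f).leadingCoeff) := by
  refine ((det_sp_support f).comp (fun s => ∃ n, s n = 1 ∧ ∀ m > n, s m = 0)).congr fun x => ?_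
  simp only [eq_iff_iff, sign_eq_one_iff, sign_eq_zero_iff]
  constructor
  · intro h
    exact ⟨_, h, fun m hm => coeff_eq_zero_of_natDegree_lt hm⟩
  · rintro ⟨n, h, h'⟩
    have : (sp x f).natDegree = n := by
      apply le_antisymm
      · exact natDegree_le_iff_coeff_eq_zero.2 h'
      · exact le_natDegree_of_ne_zero h.ne'
    rw [leadingCoeff, this]; exact h

lemma degree_erase_lt' {R : Type} [Ring R] {f : R[X]} {a : ℕ} (hf : f.degree < (a + 1 : ℕ)) :
    (f.erase a).degree < a := by
  rw [degree_lt_iff_coeff_zero] at hf ⊢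
  intro m hm
  rw [coeff_erase]
  split_ifs with h
  · rfl
  · exact hf m (by omega)

lemma degree_cancel_lt {R : Type} [CommRing R] {f g : R[X]} {a b : ℕ}
    (hf : f.degree < (a + 1 : ℕ)) (hg : g.degree < (b + 1 : ℕ)) (hab : a ≤ b) :
    (C (f.coeff a ^ 2) * g - (C (f.coeff a * g.coeff b) * X ^ (b - a)) * f).degree < ((b : ℕ) : WithBot ℕ) := by
  rw [degree_lt_iff_coeff_zero] at hf hg ⊢
  intro m hm
  obtain ⟨k, rfl⟩ : ∃ k, m = (a + k) + (b - a) := ⟨m - b, by omega⟩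
  rw [coeff_sub, mul_assoc, coeff_C_mul, coeff_C_mul, mul_comm (X ^ _), coeff_mul_X_pow]
  rcases Nat.eq_zero_or_pos k with rfl | hk
  · rw [show a + 0 + (b - a) = b by omega, add_zero]; ring
  · rw [hf (a + k) (by omega), hg (a + k + (b - a)) (by omega)]; ring

lemma sp_erase {x : σ → ℝ} {f : (MvPolynomial σ ℝ)[X]} {a : ℕ}
    (h : MvPolynomial.eval x (f.coeff a) = 0) : sp x (f.erase a) = sp x f := by
  ext i
  simp only [sp, coeff_map, coeff_erase]
  split_ifs with hi
  · subst hi; simp [h]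
  · rfl

lemma natDegree_sp {x : σ → ℝ} {f : (MvPolynomial σ ℝ)[X]} {a : ℕ}
    (hf : f.degree < (a + 1 : ℕ))
    (h : MvPolynomial.eval x (f.coeff a) ≠ 0) :
    sp x f ≠ 0 ∧ (sp x f).natDegree = a ∧
      (sp x f).leadingCoeff = MvPolynomial.eval x (f.coeff a) := by
  have hc : (sp x f).coeff a = MvPolynomial.eval x (f.coeff a) := coeff_map ..
  have h0 : sp x f ≠ 0 := by intro h'; rw [h'] at hc; simp at hc; exact h hc.symm
  have : (sp x f).natDegree = a := by
    apply le_antisymm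
    · rw [natDegree_le_iff_coeff_eq_zero]
      intro m hm
      rw [degree_lt_iff_coeff_zero] at hf
      rw [coeff_map, hf m (by omega), map_zero]
    · apply le_natDegree_of_ne_zero; rwa [hc]
  exact ⟨h0, this, by rw [leadingCoeff, this, hc]⟩

lemma sp_red (x : σ → ℝ) (c : MvPolynomial σ ℝ) (f g q : (MvPolynomial σ ℝ)[X]) :
    sp x (C (c ^ 2) * g - q * f) =
      C ((MvPolynomial.eval x c) ^ 2) * sp x g - sp x q * sp x f := by
  simp [sp]

lemma det_ind_aux (N : ℕ) : ∀ a b : ℕ, a + b = N → ∀ f g : (MvPolynomial σ ℝ)[X],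
    f.degree < a → g.degree < b → Det (fun x => ind (sp x g) (sp x f)) := by
  induction N using Nat.strong_induction_on with
  | _ N ih =>
  intro a b hab f g hf hg
  rcases a with _ | a
  · have : f = 0 := by simpa using hf
    subst this
    exact (det_const 0).congr fun x => by simp [ind]
  rcases b with _ | b
  · have : g = 0 := by simpa using hg
    subst this
    exact (det_const 0).congr fun x => by simp [ind, loc]
  have h1 := ih (a + (b + 1)) (by omega) a (b + 1) rfl (f.erase a) g (degree_erase_lt' hf) hg
  have h2 := ih ((a + 1) + b) (by omega) (a + 1) b rfl f (g.erase b) hf (degree_erase_lt' hg)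
  have h3 : Det (fun x => MvPolynomial.eval x (f.coeff a) ≠ 0 ∧
      MvPolynomial.eval x (g.coeff b) ≠ 0) := (det_zero _).not.and (det_zero _).not
  classical
  suffices ∃ M : (σ → ℝ) → ℤ, Det M ∧ ∀ x, MvPolynomial.eval x (f.coeff a) ≠ 0 →
      MvPolynomial.eval x (g.coeff b) ≠ 0 → ind (sp x g) (sp x f) = M x by
    obtain ⟨M, hM, hM'⟩ := this
    refine ((det_zero (f.coeff a)).ite h1 ((det_zero (g.coeff b)).ite h2 hM)).congr fun x => ?_
    split_ifs with c1 c2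
    · rw [sp_erase c1]
    · rw [sp_erase c2]
    · exact hM' x c1 c2
  rcases le_or_gt a b with hle | hlt
  · refine ⟨_, ih ((a + 1) + b) (by omega) (a + 1) b rfl f _ hf (degree_cancel_lt hf hg hle), ?_⟩
    intro x c1 c2
    rw [sp_red, ind_reduce _ _ _ c1]
  · have h4 := ih ((b + 1) + a) (by omega) (b + 1) a rfl g _ hg (degree_cancel_lt hg hf hlt.le)
    have h5 := det_sign (f.coeff a * g.coeff b)
    refine ⟨_, h5.comp₂ h4 (fun s i => (if Odd (a + b) then (s : ℤ) else 0) - i), ?_⟩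
    intro x c1 c2
    rw [sp_red, ind_reduce _ _ _ c2, eq_sub_iff_add_eq]
    obtain ⟨p1, p2, p3⟩ := natDegree_sp hf c1
    obtain ⟨q1, q2, q3⟩ := natDegree_sp hg c2
    rw [ind_add_ind p1 q1, tele_eq _ (mul_ne_zero p1 q1), natDegree_mul p1 q1, p2, q2,
      leadingCoeff_mul, p3, q3, MvPolynomial.eval_mul]

lemma det_ind (f g : (MvPolynomial σ ℝ)[X]) : Det (fun x => ind (sp x g) (sp x f)) :=
  det_ind_aux _ (f.natDegree + 1) (g.natDegree + 1) rfl f g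
    (degree_le_natDegree.trans_lt (by exact_mod_cast Nat.lt_succ_self _))
    (degree_le_natDegree.trans_lt (by exact_mod_cast Nat.lt_succ_self _))

open Classical in
lemma det_taq (f g : (MvPolynomial σ ℝ)[X]) :
    Det (fun x => ∑ t ∈ (sp x f).roots.toFinset,
      ((SignType.sign ((sp x g).eval t) : SignType) : ℤ)) := by
  refine ((det_sp_zero f).ite (det_const 0) (det_ind f (derivative f * g))).congr fun x => ?_
  split_ifs with h
  · simp [h]
  · have e : sp x (derivative f * g) = derivative (sp x f) * sp x g := by
      simp [sp, derivative_map]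
    rw [e, ind_derivative h]

lemma det_taq_list (f : (MvPolynomial σ ℝ)[X]) (Q : List (MvPolynomial σ ℝ)[X]) :
    ∀ g : (MvPolynomial σ ℝ)[X],
    Det (fun x => ∑ t ∈ (sp x f).roots.toFinset,
      ((SignType.sign ((sp x g).eval t) : SignType) : ℤ) * (Q.map fun q =>
        ((SignType.sign ((sp x q).eval t) : SignType) : ℤ) ^ 2 +
        ((SignType.sign ((sp x q).eval t) : SignType) : ℤ)).prod) := by
  induction Q with
  | nil => intro g; simpa using det_taq f g
  | cons q Q ih =>
    intro g
    refine ((ih (g * q ^ 2)).comp₂ (ih (g * q)) (fun a b => a + b)).congr fun x => ?_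
    rw [← Finset.sum_add_distrib]
    refine Finset.sum_congr rfl fun t _ => ?_
    simp only [List.map_cons, List.prod_cons, sp, Polynomial.map_mul, Polynomial.map_pow, eval_mul,
      eval_pow, sign_mul, sign_pow, SignType.coe_mul, SignType.coe_pow]
    ring

lemma sgn_fact (s : SignType) : 0 ≤ (s : ℤ) ^ 2 + s ∧ ((s : ℤ) ^ 2 + s ≠ 0 ↔ s = 1) := by
  revert s; decide

lemma det_ex_root (f : (MvPolynomial σ ℝ)[X]) (Q : List (MvPolynomial σ ℝ)[X]) :
    Det (fun x => sp x f ≠ 0 ∧ ∃ t, (sp x f).eval t = 0 ∧ ∀ q ∈ Q, 0 < (sp x q).eval t) := by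
  refine ((det_sp_zero f).not.and ((det_taq_list f Q 1).comp (fun z => z ≠ 0))).congr fun x => ?_
  rw [eq_iff_iff]
  refine and_congr_right fun hf => ?_
  have hnn : ∀ t : ℝ, 0 ≤ (Q.map fun q =>
        ((SignType.sign ((sp x q).eval t) : SignType) : ℤ) ^ 2 +
        ((SignType.sign ((sp x q).eval t) : SignType) : ℤ)).prod := by
    intro t
    apply List.prod_nonneg
    intro z hz
    obtain ⟨q, -, rfl⟩ := List.mem_map.1 hz
    exact (sgn_fact _).1
  simp only [sp, Polynomial.map_one, eval_one, sign_one, SignType.coe_one, one_mul]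
  rw [Ne, Finset.sum_eq_zero_iff_of_nonneg (fun t _ => hnn t)]
  push Not
  refine exists_congr fun t => ?_
  have : t ∈ (f.map (MvPolynomial.eval x)).roots.toFinset ↔
      (f.map (MvPolynomial.eval x)).eval t = 0 := by simp [hf]
  rw [this]
  refine and_congr_right fun _ => ?_
  rw [Ne, List.prod_eq_zero_iff]
  simp only [List.mem_map, not_exists, not_and]
  refine forall₂_congr fun q _ => ?_
  rw [← Ne, (sgn_fact _).2, sign_eq_one_iff]

lemma pos_of_no_root {q : ℝ[X]} {a b : ℝ} (h : ∀ y ∈ Set.uIcc a b, q.eval y ≠ 0)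
    (ha : 0 < q.eval a) : 0 < q.eval b := by
  by_contra hb
  push Not at hb
  have := intermediate_value_uIcc (a := a) (b := b) (f := fun x => q.eval x)
    q.continuous.continuousOn
  obtain ⟨y, hy, hy'⟩ := this (show (0 : ℝ) ∈ Set.uIcc (q.eval a) (q.eval b) by
    rw [Set.mem_uIcc]; right; exact ⟨hb, ha.le⟩)
  exact h y hy hy'

lemma lead_pos_of_no_root {q : ℝ[X]} {a : ℝ} (h : ∀ y, q.IsRoot y → y < a)
    (ha : 0 < q.eval a) : 0 < q.leadingCoeff := by
  have := sign_eval_of_roots_lt h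
  rw [sign_pos ha] at this
  exact sign_eq_one_iff.1 this.symm

lemma eventually_pos {q : ℝ[X]} (h : 0 < q.leadingCoeff) : ∀ᶠ t in Filter.atTop, 0 < q.eval t := by
  have hq : q ≠ 0 := by rintro rfl; simp at h
  filter_upwards [Filter.eventually_gt_atTop (∑ t ∈ q.roots.toFinset, |t|)] with t ht
  refine zero_lt_eval_of_roots_lt_of_leadingCoeff_nonneg (fun y hy => ?_) h.le
  have : |y| ≤ ∑ t ∈ q.roots.toFinset, |t| :=
    Finset.single_le_sum (f := fun t => |t|) (fun i _ => abs_nonneg i) (by simpa [hq] using hy)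
  linarith [le_abs_self y]

lemma open_case (Q : List ℝ[X]) :
    (∃ t, ∀ q ∈ Q, 0 < q.eval t) ↔
      (∀ q ∈ Q, 0 < q.leadingCoeff) ∨ (∀ q ∈ Q, 0 < (q.comp (-X)).leadingCoeff) ∨
      (derivative Q.prod ≠ 0 ∧ ∃ t, (derivative Q.prod).eval t = 0 ∧ ∀ q ∈ Q, 0 < q.eval t) := by
  have ev : ∀ Q : List ℝ[X], (∀ q ∈ Q, 0 < q.leadingCoeff) → ∃ t, ∀ q ∈ Q, 0 < q.eval t := by
    intro Q h
    have : ∀ᶠ t in Filter.atTop, ∀ q ∈ Q.toFinset, 0 < q.eval t := by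
      rw [Filter.eventually_all_finset]
      intro q hq
      exact eventually_pos (h q (by simpa using hq))
    obtain ⟨t, ht⟩ := this.exists
    exact ⟨t, fun q hq => ht q (by simpa using hq)⟩
  constructor
  · rintro ⟨a, ha⟩
    have hroot : ∀ q ∈ Q, ∀ y, q.eval y = 0 → Q.prod.eval y = 0 := by
      intro q hq y hy
      obtain ⟨r, hr⟩ := List.dvd_prod hq
      rw [hr, eval_mul, hy, zero_mul]
    have hPa : Q.prod.eval a ≠ 0 := by
      rw [eval_list_prod, Ne, List.prod_eq_zero_iff]
      simp only [List.mem_map, not_exists, not_and]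
      intro q hq h
      exact (ha q hq).ne' h
    have hP : Q.prod ≠ 0 := by intro h; rw [h] at hPa; simp at hPa
    by_cases h1 : ∃ y, Q.prod.eval y = 0 ∧ a < y
    swap
    · left
      push Not at h1
      intro q hq
      refine lead_pos_of_no_root (a := a) (fun y hy => ?_) (ha q hq)
      refine lt_of_le_of_ne (h1 y (hroot q hq y hy)) ?_
      rintro rfl; exact (ha q hq).ne' hy
    by_cases h2 : ∃ y, Q.prod.eval y = 0 ∧ y < a
    swap
    · right; left
      push Not at h2
      intro q hq
      refine lead_pos_of_no_root (a := -a) (fun y hy => ?_) (by simpa using ha q hq)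
      have hy' : q.eval (-y) = 0 := by simpa [IsRoot] using hy
      have := h2 (-y) (hroot q hq _ hy')
      have hne : a ≠ -y := by rintro rfl; exact (ha q hq).ne' hy'
      have := lt_of_le_of_ne this hne
      linarith
    right; right
    obtain ⟨u, hu, hau⟩ := h1
    obtain ⟨l, hl, hla⟩ := h2
    obtain ⟨b, hb, hbmin⟩ := (Q.prod.roots.toFinset.filter (a < ·)).exists_min_image id
      ⟨u, by simp [hP, hu, hau]⟩
    obtain ⟨c, hc, hcmax⟩ := (Q.prod.roots.toFinset.filter (· < a)).exists_max_image id
      ⟨l, by simp [hP, hl, hla]⟩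
    simp only [Finset.mem_filter, Multiset.mem_toFinset, mem_roots hP, IsRoot, id] at hb hbmin hc hcmax
    obtain ⟨d, hd, hd'⟩ := exists_deriv_eq_zero (f := fun x => Q.prod.eval x) (hc.2.trans hb.2)
      Q.prod.continuous.continuousOn (by simp only [hb.1, hc.1])
    rw [Polynomial.deriv] at hd'
    refine ⟨?_, d, hd', ?_⟩
    · intro h0
      have := derivative_eq_zero.1 h0
      obtain ⟨k, hk⟩ := natDegree_eq_zero.1 this
      rw [← hk] at hPa hu
      simp at hPa hu
      exact hPa hu
    · intro q hq
      refine pos_of_no_root (a := a) (fun y hy h0 => ?_) (ha q hq)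
      have hy0 := hroot q hq y h0
      have hya : y ≠ a := by rintro rfl; exact hPa hy0
      rw [Set.mem_uIcc] at hy
      rcases lt_or_gt_of_ne hya with h | h
      · have := hcmax y ⟨hy0, h⟩
        rcases hy with hy | hy <;> linarith [hd.1, hd.2]
      · have := hbmin y ⟨hy0, h⟩
        rcases hy with hy | hy <;> linarith [hd.1, hd.2]
  · rintro (h | h | ⟨-, t, -, h⟩)
    · exact ev Q h
    · obtain ⟨t, ht⟩ := ev (Q.map fun q => q.comp (-X)) (by simpa using h)
      refine ⟨-t, fun q hq => ?_⟩
      have := ht (q.comp (-X)) (List.mem_map_of_mem hq)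
      simpa using this
    · exact ⟨t, h⟩

lemma Det.ballList {ι : Type} {s : List ι} {P : ι → (σ → ℝ) → Prop} (h : ∀ i ∈ s, Det (P i)) :
    Det (fun x => ∀ i ∈ s, P i x) := by
  classical
  have := Det.ball (s := s.toFinset) (P := P) (fun i hi => h i (by simpa using hi))
  simpa using this

lemma det_basic (f : (MvPolynomial σ ℝ)[X]) (Q : List (MvPolynomial σ ℝ)[X]) :
    Det (fun x => ∃ t, (sp x f).eval t = 0 ∧ ∀ q ∈ Q, 0 < (sp x q).eval t) := by
  have h1 : Det (fun x => ∀ q ∈ Q, 0 < (sp x q).leadingCoeff) :=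
    Det.ballList fun q _ => det_sp_lead q
  have h2 : Det (fun x => ∀ q ∈ Q, 0 < ((sp x q).comp (-X)).leadingCoeff) :=
    Det.ballList fun q _ => (det_sp_lead (q.comp (-X))).congr fun x => by
      rw [sp, sp, Polynomial.map_comp]; simp
  have h3 := det_ex_root (derivative Q.prod) Q
  refine ((det_ex_root f Q).or ((det_sp_zero f).and (h1.or (h2.or h3)))).congr fun x => ?_
  rw [eq_iff_iff]
  by_cases hf : sp x f = 0
  · have := open_case (Q.map (sp x))
    have hp : (Q.map (sp x)).prod = sp x Q.prod := by
      simp [sp, Polynomial.map_list_prod]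
    rw [hp] at this
    simp only [List.forall_mem_map] at this
    simp only [hf, eval_zero, true_and, ne_eq, not_true_eq_false, false_and, false_or]
    rw [this, sp, sp, derivative_map]
  · simp only [hf, ne_eq, not_false_eq_true, true_and, false_and, or_false]


lemma Det.exists_form {P : (σ → ℝ) → Prop} (h : Det P) :
    ∃ (m : ℕ) (p : Fin m → MvPolynomial σ ℝ) (Q : Fin m → Finset (MvPolynomial σ ℝ)),
      ∀ x, P x ↔ ∃ i, MvPolynomial.eval x (p i) = 0 ∧ ∀ q ∈ Q i, 0 < MvPolynomial.eval x q := by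
  classical
  obtain ⟨F, hF⟩ := h
  let T := {s : F → SignType // ∃ x, P x ∧ ∀ f : F, SignType.sign (MvPolynomial.eval x f.1) = s f}
  let e := Fintype.equivFin T
  let pp : T → MvPolynomial σ ℝ := fun s => ∑ f : F, if s.1 f = 0 then f.1 ^ 2 else 0
  let QQ : T → Finset (MvPolynomial σ ℝ) := fun s =>
    (Finset.univ.filter fun f : F => s.1 f = 1).image (fun f => f.1) ∪
    (Finset.univ.filter fun f : F => s.1 f = -1).image (fun f => -f.1)
  have key : ∀ (s : T) (x : σ → ℝ), (MvPolynomial.eval x (pp s) = 0 ∧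
      ∀ q ∈ QQ s, 0 < MvPolynomial.eval x q) ↔
      ∀ f : F, SignType.sign (MvPolynomial.eval x f.1) = s.1 f := by
    intro s x
    have h1 : MvPolynomial.eval x (pp s) = 0 ↔
        ∀ f : F, s.1 f = 0 → MvPolynomial.eval x f.1 = 0 := by
      simp only [pp, map_sum]
      rw [Finset.sum_eq_zero_iff_of_nonneg]
      · refine ⟨fun h f hf => ?_, fun h f _ => ?_⟩
        · simpa [hf] using h f (Finset.mem_univ _)
        · split_ifs with hf
          · simp [h f hf]
          · simp
      · intro f _
        split_ifs
        · rw [map_pow]; positivity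
        · simp
    have h2 : (∀ q ∈ QQ s, 0 < MvPolynomial.eval x q) ↔
        (∀ f : F, s.1 f = 1 → 0 < MvPolynomial.eval x f.1) ∧
        (∀ f : F, s.1 f = -1 → MvPolynomial.eval x f.1 < 0) := by
      constructor
      · intro h
        refine ⟨fun f hf => h _ ?_, fun f hf => ?_⟩
        · exact Finset.mem_union_left _ (Finset.mem_image.2 ⟨f, by simp [hf], rfl⟩)
        · have := h (-f.1)
            (Finset.mem_union_right _ (Finset.mem_image.2 ⟨f, by simp [hf], rfl⟩))
          simpa using this
      · rintro ⟨ha, hb⟩ q hq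
        rcases Finset.mem_union.1 hq with hq | hq
        · obtain ⟨f, hf, rfl⟩ := Finset.mem_image.1 hq
          exact ha f (by simpa using hf)
        · obtain ⟨f, hf, rfl⟩ := Finset.mem_image.1 hq
          simpa using hb f (by simpa using hf)
    rw [h1, h2]
    constructor
    · rintro ⟨a, b, c⟩ f
      rcases hs : s.1 f with _ | _ | _
      · rw [a f hs]; exact sign_zero
      · exact sign_neg (c f hs)
      · exact sign_pos (b f hs)
    · intro h
      refine ⟨fun f hf => ?_, fun f hf => ?_, fun f hf => ?_⟩
      · rw [← h f] at hf; exact sign_eq_zero_iff.1 hf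
      · rw [← h f] at hf; exact sign_eq_one_iff.1 hf
      · rw [← h f] at hf; exact sign_eq_neg_one_iff.1 hf
  refine ⟨Fintype.card T, fun i => pp (e.symm i), fun i => QQ (e.symm i), fun x => ?_⟩
  simp only [key]
  constructor
  · intro hx
    refine ⟨e ⟨fun f => SignType.sign (MvPolynomial.eval x f.1), x, hx, fun _ => rfl⟩, ?_⟩
    simp
  · rintro ⟨i, hi⟩
    obtain ⟨y, hy, hy'⟩ := (e.symm i).2
    rw [hF x y]
    · exact hy
    · intro f hf
      rw [hi ⟨f, hf⟩, hy' ⟨f, hf⟩]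

lemma eval_option (x : σ → ℝ) (t : ℝ) (p : MvPolynomial (Option σ) ℝ) :
    MvPolynomial.eval (fun o : Option σ => o.elim t x) p =
      (sp x (MvPolynomial.optionEquivLeft ℝ σ p)).eval t := by
  induction p using MvPolynomial.induction_on with
  | C a => simp [sp]
  | add p q hp hq => simp only [map_add, hp, hq, sp, Polynomial.map_add, eval_add]
  | mul_X p i hp =>
    rw [map_mul, map_mul, hp]
    rcases i with _ | i <;> simp [sp]

lemma Det.exists_option {P : (Option σ → ℝ) → Prop} (h : Det P) :
    Det (fun x : σ → ℝ => ∃ t : ℝ, P (fun o => o.elim t x)) := by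
  obtain ⟨m, p, Q, hP⟩ := h.exists_form
  have := Det.ex (fun i : Fin m => det_basic (MvPolynomial.optionEquivLeft ℝ σ (p i))
    ((Q i).toList.map (MvPolynomial.optionEquivLeft ℝ σ)))
  refine this.congr fun x => ?_
  simp only [hP, eval_option, List.forall_mem_map, Finset.mem_toList]
  rw [exists_comm]

lemma Det.exists_block (m : ℕ) : ∀ {σ : Type} {P : (Fin m → ℝ) → (σ → ℝ) → Prop},
    Det (fun z : Fin m ⊕ σ → ℝ => P (z ∘ Sum.inl) (z ∘ Sum.inr)) →
    Det (fun x : σ → ℝ => ∃ y, P y x) := by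
  induction m with
  | zero =>
    intro σ P h
    refine (h.rename (Sum.elim Fin.elim0 id : Fin 0 ⊕ σ → σ)).congr fun x => ?_
    rw [eq_iff_iff]
    constructor
    · rintro ⟨y, hy⟩
      have e : y = (x ∘ (Sum.elim Fin.elim0 id : Fin 0 ⊕ σ → σ)) ∘ Sum.inl := Subsingleton.elim _ _
      rw [e] at hy
      exact hy
    · intro hy
      exact ⟨_, hy⟩
  | succ m ih =>
    intro σ P h
    have h1 := h.rename (σ := Fin m ⊕ Option σ)
      (Sum.elim (Fin.cases (Sum.inr none) (fun i => Sum.inl i)) (fun s => Sum.inr (some s)))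
    have h2 := ih (σ := Option σ) (P := fun y z => P (Fin.cons (z none) y) (z ∘ some))
      (h1.congr fun z => by
        congr 1
        funext i
        refine Fin.cases ?_ (fun j => ?_) i <;> simp)
    refine h2.exists_option.congr fun x => ?_
    rw [eq_iff_iff]
    constructor
    · rintro ⟨y, hy⟩
      refine ⟨y 0, Fin.tail y, ?_⟩
      simpa [Function.comp_def] using hy
    · rintro ⟨t, y, hy⟩
      exact ⟨Fin.cons t y, by simpa [Function.comp_def] using hy⟩

end det

end

lemma semialgebraic_iff {n : ℕ} (S : Set (Fin n → ℝ)) :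
    IsSemialgebraic S ↔ Det (fun x => x ∈ S) := by
  constructor
  · rintro ⟨m, p, Q, rfl⟩
    have := Det.ex (fun i : Fin m => (det_zero (p i)).and
      (Det.ball (s := Q i) (P := fun q x => 0 < MvPolynomial.eval x q) fun q _ => det_pos q))
    simpa using this
  · intro h
    obtain ⟨m, p, Q, hP⟩ := h.exists_form
    exact ⟨m, p, Q, by ext x; simp [hP x]⟩

lemma dist_lt_iff' {n : ℕ} (a b c d : Fin n → ℝ) :
    dist a b < 2 * dist c d ↔ ∃ j, ∀ i, 0 < 4 * (c j - d j) ^ 2 - (a i - b i) ^ 2 := by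
  have h : ∀ i j, 0 < 4 * (c j - d j) ^ 2 - (a i - b i) ^ 2 ↔
      dist (a i) (b i) < 2 * dist (c j) (d j) := by
    intro i j
    rw [Real.dist_eq, Real.dist_eq, sub_pos, ← sq_abs (a i - b i), ← sq_abs (c j - d j),
      show 4 * |c j - d j| ^ 2 = (2 * |c j - d j|) ^ 2 by ring]
    exact sq_lt_sq₀ (abs_nonneg _) (by positivity)
  simp only [h]
  constructor
  · intro hlt
    have hpos : 0 < dist c d := by linarith [dist_nonneg (x := a) (y := b)]
    by_contra! hcon
    have : dist c d ≤ dist a b / 2 := by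
      rw [dist_pi_le_iff (by positivity)]
      intro j
      obtain ⟨i, hi⟩ := hcon j
      linarith [dist_le_pi_dist a b i]
    linarith
  · rintro ⟨j, hj⟩
    have h0 : dist (c j) (d j) ≤ dist c d := dist_le_pi_dist c d j
    have : dist a b < 2 * dist (c j) (d j) := by
      rw [dist_pi_lt_iff]
      · exact hj
      · linarith [hj j, dist_nonneg (x := a j) (y := b j)]
    linarith

lemma det_dist {n : ℕ} {σ : Type} (a b c d : Fin n → σ) :
    Det (fun x : σ → ℝ => dist (x ∘ a) (x ∘ b) < 2 * dist (x ∘ c) (x ∘ d)) := by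
  have := Det.ex (fun j : Fin n => Det.all (fun i : Fin n => det_pos (σ := σ)
    (4 * (MvPolynomial.X (c j) - MvPolynomial.X (d j)) ^ 2 -
      (MvPolynomial.X (a i) - MvPolynomial.X (b i)) ^ 2)))
  refine this.congr fun x => ?_
  rw [dist_lt_iff']
  simp

lemma det_compare {n : ℕ} {A B : Set (Fin n → ℝ)} (hA : Det (fun x => x ∈ A))
    (hB : Det (fun x => x ∈ B)) :
    Det (fun x : Fin n → ℝ => ∃ c, c ∈ A ∧ ∀ d, d ∈ B → dist x c < 2 * dist x d) := by
  apply Det.exists_block n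
    (P := fun (c x : Fin n → ℝ) => c ∈ A ∧ ∀ d, d ∈ B → dist x c < 2 * dist x d)
  refine (hA.rename Sum.inl).and ?_
  have h := Det.exists_block n (σ := Fin n ⊕ Fin n)
    (P := fun d z => d ∈ B ∧ ¬ dist (z ∘ Sum.inr) (z ∘ Sum.inl) < 2 * dist (z ∘ Sum.inr) d)
    ((hB.rename Sum.inl).and
      (det_dist (Sum.inr ∘ Sum.inr) (Sum.inr ∘ Sum.inl) (Sum.inr ∘ Sum.inr) Sum.inl).not)
  refine h.not.congr fun z => ?_
  push Not
  rfl

lemma compare_iff {n : ℕ} {A B : Set (Fin n → ℝ)} (hA : IsClosed A) (hB : IsClosed B)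
    (hA' : A.Nonempty) (hB' : B.Nonempty) (x : Fin n → ℝ) :
    (∃ c, c ∈ A ∧ ∀ d, d ∈ B → dist x c < 2 * dist x d) ↔
      Metric.infDist x A < 2 * Metric.infDist x B := by
  constructor
  · rintro ⟨c, hc, h⟩
    obtain ⟨d, hd, hd'⟩ := hB.exists_infDist_eq_dist hB' x
    rw [hd']
    exact (Metric.infDist_le_dist_of_mem hc).trans_lt (h d hd)
  · intro h
    obtain ⟨c, hc, hc'⟩ := hA.exists_infDist_eq_dist hA' x
    refine ⟨c, hc, fun d hd => ?_⟩
    have := Metric.infDist_le_dist_of_mem (x := x) hd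
    linarith

end TS

/-- Proper refinement of semialgebraic covers: every finite cover of a closed
semialgebraic `M ⊆ ℝⁿ` by relatively open semialgebraic subsets admits a finite
refinement by relatively open semialgebraic subsets whose closures in `M` are
contained in members of the original cover. -/
theorem stmt_15 {n k : ℕ} (M : Set (Fin n → ℝ))
    (hMcl : IsClosed M) (hMsa : IsSemialgebraic M)
    (U : Fin k → Set (Fin n → ℝ))
    (hUsa : ∀ i, IsSemialgebraic (U i))
    (hUo : ∀ i, ∃ V, IsOpen V ∧ U i = V ∩ M)
    (hcov : (⋃ i, U i) = M) :
    ∃ (m : ℕ) (V : Fin m → Set (Fin n → ℝ)),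
      (∀ j, IsSemialgebraic (V j)) ∧
      (∀ j, ∃ O, IsOpen O ∧ V j = O ∩ M) ∧
      (⋃ j, V j) = M ∧
      ∀ j, ∃ i, M ∩ closure (V j) ⊆ U i := by
  by_cases htriv : ∃ i, M \ U i = ∅
  · obtain ⟨i, hi⟩ := htriv
    refine ⟨1, fun _ => M, fun _ => hMsa, fun _ => ⟨Set.univ, isOpen_univ, by simp⟩,
      Set.iUnion_const M,
      fun _ => ⟨i, ?_⟩⟩
    exact Set.inter_subset_left.trans (Set.sdiff_eq_empty.1 hi)
  push Not at htriv
  have hne : ∀ i, (M \ U i).Nonempty := fun i => by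
    simpa [Set.nonempty_iff_ne_empty] using htriv i
  have hcl : ∀ i, IsClosed (M \ U i) := by
    intro i
    obtain ⟨O, hO, e⟩ := hUo i
    have : M \ U i = M ∩ Oᶜ := by
      rw [e]; ext x; simp
    rw [this]
    exact hMcl.inter hO.isClosed_compl
  let δ : Fin k → (Fin n → ℝ) → ℝ := fun i x => Metric.infDist x (M \ U i)
  have hδc : ∀ i, Continuous (δ i) := fun i => Metric.continuous_infDist_pt _
  have hδ0 : ∀ i x, 0 ≤ δ i x := fun i x => Metric.infDist_nonneg
  have hδpos : ∀ i x, x ∈ M → (0 < δ i x ↔ x ∈ U i) := by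
    intro i x hx
    rw [← (hcl i).notMem_iff_infDist_pos (hne i)]
    simp [hx]
  have hex : ∀ x ∈ M, ∃ i, 0 < δ i x := by
    intro x hx
    have hx' := hx
    rw [← hcov] at hx'
    obtain ⟨i, hi⟩ := Set.mem_iUnion.1 hx'
    exact ⟨i, (hδpos i x hx).2 hi⟩
  refine ⟨k, fun i => {x | x ∈ M ∧ ∀ j, δ j x < 2 * δ i x}, fun i => ?_, fun i => ?_, ?_,
    fun i => ⟨i, ?_⟩⟩
  · rw [TS.semialgebraic_iff] at hMsa ⊢
    have hd : ∀ i, TS.Det (fun x => x ∈ M \ U i) := fun i =>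
      hMsa.and ((TS.semialgebraic_iff _).1 (hUsa i)).not
    refine (hMsa.and (TS.Det.all fun j => TS.det_compare (hd j) (hd i))).congr fun x => ?_
    rw [eq_iff_iff]
    refine and_congr_right fun _ => forall_congr' fun j => ?_
    exact (TS.compare_iff (hcl j) (hcl i) (hne j) (hne i) x).symm
  · refine ⟨{x | ∀ j, δ j x < 2 * δ i x}, ?_, ?_⟩
    · rw [Set.ofPred_forall]
      exact isOpen_iInter_of_finite fun j => isOpen_lt (hδc j) ((hδc i).const_mul 2)
    · ext x; simp [and_comm]
  · ext x
    simp only [Set.mem_iUnion, Set.mem_ofPred_eq]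
    constructor
    · rintro ⟨i, hx, -⟩; exact hx
    · intro hx
      obtain ⟨i₀, hi₀⟩ := hex x hx
      obtain ⟨i, -, hi⟩ := Finset.univ.exists_max_image (fun i => δ i x) ⟨i₀, Finset.mem_univ _⟩
      refine ⟨i, hx, fun j => ?_⟩
      have h1 := hi j (Finset.mem_univ _)
      have h2 := hi i₀ (Finset.mem_univ _)
      linarith
  · rintro x ⟨hx, hxc⟩
    have hsub : closure {x | x ∈ M ∧ ∀ j, δ j x < 2 * δ i x} ⊆ {x | ∀ j, δ j x ≤ 2 * δ i x} := by
      apply closure_minimal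
      · rintro y ⟨-, hy⟩ j
        exact (hy j).le
      · rw [Set.ofPred_forall]
        exact isClosed_iInter fun j => isClosed_le (hδc j) ((hδc i).const_mul 2)
    obtain ⟨j, hj⟩ := hex x hx
    rw [← hδpos i x hx]
    have := hsub hxc j
    linarith
end
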